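/- arXiv:2602.23030 — 5 statements merged into one kernel-verified Lean document; each statement's English description precedes it below -/
import Mathlib

section
/- Fix n ≥ 3, 1 ≤ r ≤ ℓ_n, w ∈ Σ^r, and any shuffler S over Σ. Let L ≥ 0 and u, v ∈ Σ^L, and write m = m_{n,r} = ⌊n/r⌋. Assume 4L ≤ ε_n·m and ε_n ≤ k^{−r}. Then μ(E_S(n,r,w)^c | [u]×[v]) ≤ 2·exp(−(ε_n²/12)·m·k^r). -/
open MeasureTheory Filter Finset
open scoped ENNReal ProbabilityTheory

/-- A deterministic shuffler over the alphabet `Fin k`, with state set `Fin S.n`.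
`τ q = true` means: read from tape 1 (the `x` tape); `τ q = false` means tape 2. -/
structure Shuffler (k : ℕ) where
  n : ℕ
  q0 : Fin n
  δ : Fin n → Fin k → Fin n
  τ : Fin n → Bool

namespace Shuffler

variable {k : ℕ}

/-- Configuration after `t` output steps: current state, and the numbers of symbols
consumed from tape 1 and from tape 2. -/
def conf (S : Shuffler k) (x y : ℕ → Fin k) : ℕ → Fin S.n × ℕ × ℕ
  | 0 => (S.q0, 0, 0)
  | t + 1 =>
    match S.conf x y t with
    | (q, a, b) =>
      if S.τ q then (S.δ q (x a), a + 1, b) else (S.δ q (y b), a, b + 1)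

/-- The shuffled output word `S(x,y) : ℕ → Fin k`. -/
def out (S : Shuffler k) (x y : ℕ → Fin k) (t : ℕ) : Fin k :=
  match S.conf x y t with
  | (q, a, b) => if S.τ q then x a else y b

end Shuffler

/-- The length-`n` prefix of an infinite word. -/
def wpre {k : ℕ} (x : ℕ → Fin k) (n : ℕ) : List (Fin k) :=
  List.ofFn (fun i : Fin n => x i)

/-- Overlapping occurrence count of the block `w` inside the finite word `u`. -/
def occ {k : ℕ} (u w : List (Fin k)) : ℕ :=
  ((Finset.range (u.length + 1 - w.length)).filter
    (fun t => (u.drop t).take w.length = w)).card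

/-- Aligned (non-overlapping) occurrence count of `w` among the consecutive
`|w|`-blocks of `u`. -/
def alocc {k : ℕ} (u w : List (Fin k)) : ℕ :=
  ((Finset.range (u.length / w.length)).filter
    (fun j => (u.drop (j * w.length)).take w.length = w)).card

/-- Borel normality of an infinite word over `Fin k`. -/
def IsNormal {k : ℕ} (z : ℕ → Fin k) : Prop :=
  ∀ w : List (Fin k), w ≠ [] →
    Tendsto (fun n => (occ (wpre z n) w : ℝ) / (n : ℝ)) atTop
      (nhds ((1 : ℝ) / (k : ℝ) ^ w.length))

/-- The cylinder determined by a finite word. -/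
def cyl {k : ℕ} (u : List (Fin k)) : Set (ℕ → Fin k) :=
  {x | wpre x u.length = u}

/-- `ν` is the i.i.d. uniform product measure on `ℕ → Fin k`:
it gives every cylinder of a length-`n` word measure `k⁻ⁿ`. -/
def IsUniformProductMeasure {k : ℕ} (ν : Measure (ℕ → Fin k)) : Prop :=
  IsProbabilityMeasure ν ∧ ∀ u : List (Fin k), ν (cyl u) = ((k : ℝ≥0∞))⁻¹ ^ u.length

noncomputable def elln (k n : ℕ) : ℕ := ⌊Real.logb k n / 3⌋₊

noncomputable def epsn (k n : ℕ) : ℝ :=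
  2 * Real.sqrt (Real.log n * Real.logb k n / n)

def mnr (n r : ℕ) : ℕ := n / r

/-- The good event `E_S(n, r, w)` (with `r = w.length`). -/
def ESet {k : ℕ} (S : Shuffler k) (n : ℕ) (w : List (Fin k)) :
    Set ((ℕ → Fin k) × (ℕ → Fin k)) :=
  {p | |(alocc (wpre (S.out p.1 p.2) n) w : ℝ) - (mnr n w.length : ℝ) / (k : ℝ) ^ w.length|
        < epsn k n * (mnr n w.length : ℝ)}

/-- Total conditional bad mass `B_n(u,v)` for the first `n` shufflers of the sequence `S`. -/
noncomputable def Bn {k : ℕ} (μ : Measure ((ℕ → Fin k) × (ℕ → Fin k)))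
    (S : ℕ → Shuffler k) (n : ℕ) (u v : List (Fin k)) : ℝ≥0∞ :=
  ∑ i ∈ Finset.Icc 1 n, ∑ r ∈ Finset.Icc 1 (elln k n), ∑ w : Fin r → Fin k,
    ProbabilityTheory.cond μ (cyl u ×ˢ cyl v) (ESet (S i) n (List.ofFn w))ᶜ

/-- The rolling potential `Φ_L(u,v)` with checkpoints `N_j = (j+m₀)^4`
and activation lengths `A_j = (j+m₀)^2`. -/
noncomputable def Phi {k : ℕ} (μ : Measure ((ℕ → Fin k) × (ℕ → Fin k)))
    (S : ℕ → Shuffler k) (m₀ : ℕ) (L : ℕ) (u v : List (Fin k)) : ℝ≥0∞ :=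
  ∑ j ∈ (Finset.Icc 1 L).filter (fun j => (j + m₀) ^ 2 ≤ L ∧ L ≤ (j + m₀) ^ 4),
    Bn μ S ((j + m₀) ^ 4) u v

/-- `Test(u; m, ε)`: all `m`-blocks of `u` have frequency within `ε` of `k^{-m}`. -/
def TestP {k : ℕ} (u : List (Fin k)) (m : ℕ) (ε : ℝ) : Prop :=
  ∀ w : List (Fin k), w.length = m →
    |(occ u w : ℝ) / (u.length : ℝ) - (1 : ℝ) / (k : ℝ) ^ m| ≤ ε

/-- The test event `E_S(n; m, ε)`. -/
def ETest {k : ℕ} (S : Shuffler k) (n m : ℕ) (ε : ℝ) :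
    Set ((ℕ → Fin k) × (ℕ → Fin k)) :=
  {p | TestP (wpre (S.out p.1 p.2) n) m ε}

/-- The quadratic window slice `H_t(N)(x)`. -/
def Hslice {k : ℕ} (S : ℕ → Shuffler k) (t N : ℕ) (x : ℕ → Fin k) :
    Set (ℕ → Fin k) :=
  ⋂ i ∈ Finset.Icc 1 t, ⋂ ℓ ∈ Finset.Icc 1 t, ⋂ n ∈ Finset.Icc N (N ^ 2),
    {y | (x, y) ∈ ETest (S i) n ℓ ((1 : ℝ) / 2 ^ t)}

/-- A finite encoding of a shuffler, suitable for computability statements. -/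
def Shuffler.encode {k : ℕ} (S : Shuffler k) : ℕ × ℕ × List ℕ × List Bool :=
  (S.n, (S.q0 : ℕ),
    (List.finRange S.n).flatMap (fun q => (List.finRange k).map (fun a => ((S.δ q a : ℕ)))),
    (List.finRange S.n).map S.τ)

/-- The word `x` with its prefix overwritten by the finite word `u`. -/
def overwrite {k : ℕ} (u : List (Fin k)) (x : ℕ → Fin k) : ℕ → Fin k :=
  fun i => u.getD i (x i)

/-- The words agreeing with `g` on the finite set of positions `F`. -/
def agreeSet {k : ℕ} (F : Finset ℕ) (g : ℕ → Fin k) : Set (ℕ → Fin k) :=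
  {x | ∀ i ∈ F, x i = g i}

lemma measurableSet_agreeSet {k : ℕ} (F : Finset ℕ) (g : ℕ → Fin k) :
    MeasurableSet (agreeSet F g) := by
  have : agreeSet F g = ⋂ i ∈ F, (fun x : ℕ → Fin k => x i) ⁻¹' {g i} := by
    ext x; simp [agreeSet]
  rw [this]
  exact F.measurableSet_biInter fun i _ => measurable_pi_apply i (measurableSet_singleton _)

lemma mem_cyl_iff {k : ℕ} (u : List (Fin k)) (x : ℕ → Fin k) :
    x ∈ cyl u ↔ ∀ i (h : i < u.length), x i = u[i] := by
  simp only [cyl, wpre, Set.mem_ofPred_eq]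
  constructor
  · intro h i hi
    have := List.getElem_of_eq h (by simpa using hi : i < _)
    simpa using this
  · intro h
    refine List.ext_getElem (by simp) fun i h1 h2 => ?_
    simpa using h i h2

lemma cyl_ofFn_eq_agreeSet {k : ℕ} (N : ℕ) (g : ℕ → Fin k) :
    cyl (List.ofFn fun i : Fin N => g i) = agreeSet (range N) g := by
  ext x
  simp [mem_cyl_iff, agreeSet]

lemma cyl_eq_agreeSet {k : ℕ} (u : List (Fin k)) (x : ℕ → Fin k) :
    cyl u = agreeSet (range u.length) (overwrite u x) := by
  ext y
  simp only [mem_cyl_iff, agreeSet, Set.mem_ofPred_eq, mem_range, overwrite]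
  refine forall₂_congr fun i h => ?_
  simp [h]

lemma measurableSet_cyl {k : ℕ} (u : List (Fin k)) : MeasurableSet (cyl u) := by
  rcases (cyl u).eq_empty_or_nonempty with h | ⟨x, -⟩
  · simp [h]
  · rw [cyl_eq_agreeSet u x]
    exact measurableSet_agreeSet _ _

lemma agreeSet_eq_iUnion_update {k : ℕ} (F : Finset ℕ) (g : ℕ → Fin k) (j : ℕ) (hj : j ∉ F) :
    agreeSet F g = ⋃ c : Fin k, agreeSet (insert j F) (Function.update g j c) := by
  ext x
  simp only [agreeSet, Set.mem_ofPred_eq, Set.mem_iUnion, mem_insert, forall_eq_or_imp,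
    Function.update_self, exists_eq_left']
  refine forall₂_congr fun i hi => ?_
  rw [Function.update_of_ne (by rintro rfl; exact hj hi)]

lemma measure_agreeSet {k : ℕ} (hk : k ≠ 0) {ν : Measure (ℕ → Fin k)}
    (hν : IsUniformProductMeasure ν) (F : Finset ℕ) (g : ℕ → Fin k) :
    ν (agreeSet F g) = ((k : ℝ≥0∞))⁻¹ ^ F.card := by
  obtain ⟨N, hN⟩ : ∃ N, F ⊆ range N := ⟨F.sup id + 1, fun i hi =>
    mem_range.2 (Nat.lt_succ_of_le (Finset.le_sup (f := id) hi))⟩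
  induction hd : (range N \ F).card generalizing F g with
  | zero =>
    obtain rfl : F = range N :=
      Subset.antisymm hN (sdiff_eq_empty_iff_subset.1 (card_eq_zero.1 hd))
    rw [← cyl_ofFn_eq_agreeSet, hν.2]
    simp
  | succ d ih =>
    obtain ⟨j, hj⟩ : (range N \ F).Nonempty := card_pos.1 (by omega)
    obtain ⟨hjN, hjF⟩ := mem_sdiff.1 hj
    have hsub : insert j F ⊆ range N := insert_subset hjN hN
    have hcard : (range N \ insert j F).card = d := by
      rw [sdiff_insert, card_erase_of_mem hj, hd]; rfl
    rw [agreeSet_eq_iUnion_update F g j hjF, measure_iUnion _ fun c => measurableSet_agreeSet _ _,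
      tsum_fintype]
    · simp only [ih _ _ hsub hcard, sum_const, card_univ, Fintype.card_fin, nsmul_eq_mul,
        card_insert_of_notMem hjF, pow_succ']
      rw [← mul_assoc, ENNReal.mul_inv_cancel (by simpa using hk) (by simp), one_mul]
    · intro c d hcd
      refine Set.disjoint_left.2 fun x hc hd => hcd ?_
      have h1 := hc j (mem_insert_self _ _)
      have h2 := hd j (mem_insert_self _ _)
      simp only [Function.update_self] at h1 h2
      rw [← h1, h2]

lemma measurable_overwrite {k : ℕ} (u : List (Fin k)) : Measurable (overwrite u) := by
  refine measurable_pi_lambda _ fun i => ?_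
  by_cases h : i < u.length
  · simp [overwrite, h]
  · simpa [overwrite, h] using measurable_pi_apply i

lemma generateFrom_range_cyl {k : ℕ} :
    (MeasurableSpace.pi : MeasurableSpace (ℕ → Fin k)) =
      MeasurableSpace.generateFrom (insert ∅ (Set.range cyl)) := by
  apply le_antisymm
  · refine iSup_le fun i => ?_
    rw [← measurable_iff_comap_le]
    refine @measurable_to_countable' _ _ _ _ (_) _ fun c => ?_
    have : (fun x : ℕ → Fin k => x i) ⁻¹' {c} =
        ⋃ g : {g : Fin (i + 1) → Fin k // g (Fin.last i) = c}, cyl (List.ofFn g.1) := by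
      ext x
      simp only [Set.mem_preimage, Set.mem_singleton_iff, Set.mem_iUnion, mem_cyl_iff]
      constructor
      · intro h
        exact ⟨⟨fun j => x j, by simpa using h⟩, fun j hj => by rw [List.getElem_ofFn]⟩
      · rintro ⟨⟨g, hg⟩, h⟩
        have := h i (by simp)
        rw [List.getElem_ofFn] at this
        exact this.trans hg
    rw [this]
    exact MeasurableSet.iUnion fun g => MeasurableSpace.measurableSet_generateFrom (by simp)
  · refine MeasurableSpace.generateFrom_le ?_
    rintro s (rfl | ⟨w, rfl⟩)
    · exact MeasurableSet.empty
    · exact measurableSet_cyl w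

lemma cyl_subset_of_mem {k : ℕ} {u w : List (Fin k)} (h : u.length ≤ w.length) {x : ℕ → Fin k}
    (hu : x ∈ cyl u) (hw : x ∈ cyl w) : cyl w ⊆ cyl u := by
  intro y hy
  rw [mem_cyl_iff] at *
  intro i hi
  rw [hy i (by omega), ← hw i (by omega), hu i hi]

lemma isPiSystem_range_cyl {k : ℕ} :
    IsPiSystem (insert ∅ (Set.range (cyl (k := k)))) := by
  rintro s (rfl | ⟨u, rfl⟩) t (rfl | ⟨w, rfl⟩) ⟨x, hx, hx'⟩
  · simp
  · simp
  · simp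
  · rcases le_total u.length w.length with h | h
    · rw [Set.inter_eq_right.2 (cyl_subset_of_mem h hx hx')]; simp
    · rw [Set.inter_eq_left.2 (cyl_subset_of_mem h hx' hx)]; simp

lemma cond_cyl_eq_map {k : ℕ} (hk : k ≠ 0) {ν : Measure (ℕ → Fin k)}
    (hν : IsUniformProductMeasure ν) (u : List (Fin k)) :
    ProbabilityTheory.cond ν (cyl u) = ν.map (overwrite u) := by
  have := hν.1
  have hk0 : (k : ℝ≥0∞) ≠ 0 := by simpa using hk
  have hne : ν (cyl u) ≠ 0 := by
    rw [hν.2]; exact pow_ne_zero _ (by simp)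
  have := ProbabilityTheory.cond_isProbabilityMeasure hne
  have := Measure.isProbabilityMeasure_map (μ := ν) (measurable_overwrite u).aemeasurable
  refine ext_of_generate_finite _ generateFrom_range_cyl isPiSystem_range_cyl ?_ (by simp)
  rintro s (rfl | ⟨w, rfl⟩)
  · simp
  rw [ProbabilityTheory.cond_apply (measurableSet_cyl u),
    Measure.map_apply (measurable_overwrite u) (measurableSet_cyl w)]
  rcases (cyl u ∩ cyl w).eq_empty_or_nonempty with h | ⟨x, hx, hx'⟩
  · have : overwrite u ⁻¹' cyl w = ∅ := by
      refine Set.eq_empty_iff_forall_notMem.2 fun y hy => ?_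
      have : overwrite u y ∈ cyl u ∩ cyl w := by
        refine ⟨?_, hy⟩
        rw [mem_cyl_iff]
        intro i hi
        simp [overwrite, hi]
      rw [h] at this
      exact this
    simp [h, this]
  · have hux := (mem_cyl_iff _ _).1 hx
    have hwx := (mem_cyl_iff _ _).1 hx'
    have h1 : cyl u ∩ cyl w = agreeSet (range (max u.length w.length)) x := by
      ext y
      simp only [Set.mem_inter_iff, mem_cyl_iff, agreeSet, Set.mem_ofPred_eq, mem_range,
        lt_max_iff]
      constructor
      · rintro ⟨h, h'⟩ i (hi | hi)
        · rw [h i hi, hux i hi]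
        · rw [h' i hi, hwx i hi]
      · intro h
        exact ⟨fun i hi => by rw [h i (.inl hi), hux i hi],
          fun i hi => by rw [h i (.inr hi), hwx i hi]⟩
    have h2 : overwrite u ⁻¹' cyl w = agreeSet (Ico u.length w.length) x := by
      ext y
      simp only [Set.mem_preimage, mem_cyl_iff, agreeSet, Set.mem_ofPred_eq, mem_Ico]
      constructor
      · rintro h i ⟨hi, hi'⟩
        have := h i hi'
        rw [← hwx i hi'] at this
        simpa [overwrite, hi] using this
      · intro h i hi
        by_cases hiu : i < u.length
        · rw [← hwx i hi, hux i hiu]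
          simp [overwrite, hiu]
        · rw [← hwx i hi, ← h i ⟨by omega, hi⟩]
          simp [overwrite, hiu]
    rw [h1, h2, measure_agreeSet hk hν, measure_agreeSet hk hν, hν.2, card_range, Nat.card_Ico,
      show max u.length w.length = u.length + (w.length - u.length) by omega, pow_add, ← mul_assoc,
      ENNReal.inv_mul_cancel (pow_ne_zero _ (by simp)) (ENNReal.pow_ne_top (by simpa using hk)),
      one_mul]

lemma cond_prod_cyl_eq_map {k : ℕ} (hk : k ≠ 0) {ν : Measure (ℕ → Fin k)}
    (hν : IsUniformProductMeasure ν) (u v : List (Fin k)) :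
    ProbabilityTheory.cond (ν.prod ν) (cyl u ×ˢ cyl v) =
      (ν.prod ν).map (Prod.map (overwrite u) (overwrite v)) := by
  have := hν.1
  rw [← Measure.map_prod_map _ _ (measurable_overwrite u) (measurable_overwrite v),
    ← cond_cyl_eq_map hk hν, ← cond_cyl_eq_map hk hν]
  simp only [ProbabilityTheory.cond, Measure.prod_smul_left, Measure.prod_smul_right,
    Measure.prod_restrict, Measure.prod_prod, smul_smul]
  congr 1
  rw [ENNReal.mul_inv (by simp) (by simp), mul_comm]

namespace Shuffler

variable {k : ℕ}

/-- The symbol at the position read at step `t` of the run on `(x', y')`,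
taken from the tapes `(x, y)`. -/
def readAlong (S : Shuffler k) (x' y' x y : ℕ → Fin k) (t : ℕ) : Fin k :=
  if S.τ (S.conf x' y' t).1 then x (S.conf x' y' t).2.1 else y (S.conf x' y' t).2.2

lemma out_eq_readAlong (S : Shuffler k) (x y : ℕ → Fin k) (t : ℕ) :
    S.out x y t = S.readAlong x y x y t := rfl

lemma conf_succ (S : Shuffler k) (x y : ℕ → Fin k) (t : ℕ) :
    S.conf x y (t + 1) =
      if S.τ (S.conf x y t).1 then
        (S.δ (S.conf x y t).1 (x (S.conf x y t).2.1), (S.conf x y t).2.1 + 1, (S.conf x y t).2.2)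
      else
        (S.δ (S.conf x y t).1 (y (S.conf x y t).2.2), (S.conf x y t).2.1,
          (S.conf x y t).2.2 + 1) := rfl

/-- The pairs whose symbols read along the run on symbolwise modified tapes start with a given
word form a rectangle of cylinders of total length the length of that word. -/
lemma readAlong_prefix_eq_prod (S : Shuffler k) (φ ψ : ℕ → Fin k → Fin k) (z : ℕ → Fin k)
    (t : ℕ) : ∃ (q : Fin S.n) (a b : ℕ) (g h : ℕ → Fin k), a + b = t ∧
      {p : (ℕ → Fin k) × (ℕ → Fin k) | ∀ i < t,
          S.readAlong (fun i => φ i (p.1 i)) (fun i => ψ i (p.2 i)) p.1 p.2 i = z i} =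
        agreeSet (range a) g ×ˢ agreeSet (range b) h ∧
      ∀ x ∈ agreeSet (range a) g, ∀ y ∈ agreeSet (range b) h,
        S.conf (fun i => φ i (x i)) (fun i => ψ i (y i)) t = (q, a, b) := by
  have update_mem : ∀ (a : ℕ) (g x : ℕ → Fin k) (c : Fin k),
      x ∈ agreeSet (range (a + 1)) (Function.update g a c) ↔
        x ∈ agreeSet (range a) g ∧ x a = c := by
    intro a g x c
    simp only [agreeSet, Set.mem_ofPred_eq, range_add_one, mem_insert, forall_eq_or_imp,
      Function.update_self, and_comm (a := x a = c)]
    refine and_congr_left fun _ => forall₂_congr fun i hi => ?_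
    rw [Function.update_of_ne (by rintro rfl; simp at hi)]
  induction t with
  | zero => exact ⟨S.q0, 0, 0, z, z, rfl, by ext; simp [agreeSet], fun _ _ _ _ => rfl⟩
  | succ t ih =>
    obtain ⟨q, a, b, g, h, hab, hset, hconf⟩ := ih
    have hset' : ∀ p : (ℕ → Fin k) × (ℕ → Fin k), (∀ i < t,
          S.readAlong (fun i => φ i (p.1 i)) (fun i => ψ i (p.2 i)) p.1 p.2 i = z i) ↔
        p.1 ∈ agreeSet (range a) g ∧ p.2 ∈ agreeSet (range b) h := fun p =>
      Set.ext_iff.1 hset p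
    by_cases hq : S.τ q
    · refine ⟨S.δ q (φ a (z t)), a + 1, b, Function.update g a (z t), h, by omega, ?_, ?_⟩
      · ext ⟨x, y⟩
        simp only [Set.mem_ofPred_eq, Set.mem_prod, update_mem, Nat.forall_lt_succ_right, hset']
        rw [and_right_comm (b := x a = z t)]
        refine and_congr_right fun hxy => ?_
        rw [readAlong, hconf x hxy.1 y hxy.2]
        simp [hq]
      · intro x hx y hy
        rw [update_mem] at hx
        rw [conf_succ, hconf x hx.1 y hy]
        simp [hq, hx.2]
    · refine ⟨S.δ q (ψ b (z t)), a, b + 1, g, Function.update h b (z t), by omega, ?_, ?_⟩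
      · ext ⟨x, y⟩
        simp only [Set.mem_ofPred_eq, Set.mem_prod, update_mem, Nat.forall_lt_succ_right, hset']
        rw [and_assoc]
        refine and_congr_right fun hx => and_congr_right fun hy => ?_
        rw [readAlong, hconf x hx y hy]
        simp [hq]
      · intro x hx y hy
        rw [update_mem] at hy
        rw [conf_succ, hconf x hx y hy.1]
        simp [hq, hy.2]

lemma measure_readAlong_prefix (hk : k ≠ 0) {ν : Measure (ℕ → Fin k)}
    (hν : IsUniformProductMeasure ν) (S : Shuffler k) (u v : List (Fin k)) (z : ℕ → Fin k)
    (t : ℕ) :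
    ν.prod ν {p | ∀ i < t, S.readAlong (overwrite u p.1) (overwrite v p.2) p.1 p.2 i = z i} =
      ((k : ℝ≥0∞))⁻¹ ^ t := by
  have := hν.1
  obtain ⟨-, a, b, g, h, hab, hset, -⟩ :=
    S.readAlong_prefix_eq_prod (fun i c => u.getD i c) (fun i c => v.getD i c) z t
  refine (congrArg (ν.prod ν) hset).trans ?_
  rw [Measure.prod_prod, measure_agreeSet hk hν, measure_agreeSet hk hν, ← pow_add, card_range,
    card_range, hab]

lemma measurable_out (S : Shuffler k) (n : ℕ) :
    Measurable fun (p : (ℕ → Fin k) × (ℕ → Fin k)) (i : Fin n) => S.out p.1 p.2 i := by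
  refine measurable_to_countable' fun z => ?_
  rcases isEmpty_or_nonempty (Fin k) with hk | ⟨⟨c⟩⟩
  · have : IsEmpty ((ℕ → Fin k) × (ℕ → Fin k)) := ⟨fun p => hk.elim (p.1 0)⟩
    exact Subsingleton.measurableSet
  obtain ⟨-, a, b, g, h, -, hset, -⟩ := S.readAlong_prefix_eq_prod (fun _ c => c) (fun _ c => c)
    (fun i => if hi : i < n then z ⟨i, hi⟩ else c) n
  convert (measurableSet_agreeSet (range a) g).prod (measurableSet_agreeSet (range b) h)
  rw [← hset]
  ext p
  simp only [Set.mem_preimage, Set.mem_singleton_iff, funext_iff, Fin.forall_iff,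
    Set.mem_ofPred_eq, out_eq_readAlong]
  refine forall₂_congr fun i hi => ?_
  simp [hi]

lemma card_out_ne_readAlong_le (S : Shuffler k) (u v : List (Fin k)) (x y : ℕ → Fin k) (n : ℕ) :
    #{t ∈ range n | S.out (overwrite u x) (overwrite v y) t ≠
      S.readAlong (overwrite u x) (overwrite v y) x y t} ≤ u.length + v.length := by
  set c := S.conf (overwrite u x) (overwrite v y) with hc
  suffices h : #{t ∈ range n | S.out (overwrite u x) (overwrite v y) t ≠
      S.readAlong (overwrite u x) (overwrite v y) x y t} ≤
      min (c n).2.1 u.length + min (c n).2.2 v.length by omega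
  have overwrite_of_le : ∀ (u : List (Fin k)) (x : ℕ → Fin k) (i : ℕ), u.length ≤ i →
      overwrite u x i = x i := fun u x i h => by simp [overwrite, h]
  induction n with
  | zero => simp
  | succ n ih =>
    rw [range_add_one, filter_insert]
    have hstep : c (n + 1) = _ := S.conf_succ _ _ n
    rw [hstep]
    simp only [out_eq_readAlong, readAlong, ← hc] at ih ⊢
    have card_step := card_insert_le n {t ∈ range n | (if S.τ (c t).1 = true then
      overwrite u x (c t).2.1 else overwrite v y (c t).2.2) ≠
        if S.τ (c t).1 = true then x (c t).2.1 else y (c t).2.2}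
    cases hq : S.τ (c n).1
    · simp only [Bool.false_eq_true, if_false]
      by_cases hne : overwrite v y (c n).2.2 = y (c n).2.2
      · rw [if_neg (not_not.2 hne)]
        omega
      · have : (c n).2.2 < v.length := by
          by_contra hle
          exact hne (overwrite_of_le _ _ _ (by omega))
        rw [if_pos hne]
        omega
    · simp only [if_true]
      by_cases hne : overwrite u x (c n).2.1 = x (c n).2.1
      · rw [if_neg (not_not.2 hne)]
        omega
      · have : (c n).2.1 < u.length := by
          by_contra hle
          exact hne (overwrite_of_le _ _ _ (by omega))
        rw [if_pos hne]
        omega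

end Shuffler

/-- The `r`-aligned occurrences of the block `w` among the first `m` blocks of `o`. -/
def blockHits {k r : ℕ} (w : Fin r → Fin k) (m : ℕ) (o : ℕ → Fin k) : Finset ℕ :=
  {j ∈ range m | ∀ i : Fin r, o (j * r + i) = w i}

lemma alocc_wpre {k : ℕ} (o : ℕ → Fin k) (n : ℕ) (w : List (Fin k)) :
    alocc (wpre o n) w = #(blockHits w.get (n / w.length) o) := by
  rw [alocc, blockHits]
  have hlen : (wpre o n).length = n := by simp [wpre]
  rw [hlen]
  congr 1
  refine filter_congr fun j hj => ?_
  have hle : (j + 1) * w.length ≤ n :=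
    (Nat.mul_le_mul_right _ (mem_range.1 hj)).trans (Nat.div_mul_le_self n _)
  rw [Nat.succ_mul] at hle
  constructor
  · intro h i
    have := List.getElem_of_eq h.symm i.2
    rw [List.get_eq_getElem, this]
    simp [wpre]
  · intro h
    refine List.ext_getElem (by simp [hlen]; omega) fun i h1 h2 => ?_
    have := h ⟨i, h2⟩
    simpa [wpre] using this

lemma card_blockHits_le {k r : ℕ} (w : Fin r → Fin k) (m : ℕ) (o o' : ℕ → Fin k) :
    #(blockHits w m o) ≤ #(blockHits w m o') + #{t ∈ range (m * r) | o t ≠ o' t} := by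
  have hsub : blockHits w m o ⊆
      blockHits w m o' ∪ {t ∈ range (m * r) | o t ≠ o' t}.image (· / r) := by
    intro j hj
    simp only [blockHits, mem_filter, mem_range] at hj
    rw [mem_union]
    by_cases h : ∀ i : Fin r, o' (j * r + i) = w i
    · exact .inl (by simpa [blockHits] using ⟨hj.1, h⟩)
    · push Not at h
      obtain ⟨i, hi⟩ := h
      have hir := i.2
      refine .inr (mem_image.2 ⟨j * r + i, ?_, ?_⟩)
      · have : (j + 1) * r ≤ m * r := Nat.mul_le_mul_right _ hj.1
        rw [Nat.succ_mul] at this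
        refine mem_filter.2 ⟨mem_range.2 (by omega), ?_⟩
        rw [hj.2 i]
        exact hi.symm
      · rw [mul_comm, Nat.mul_add_div (by omega), Nat.div_eq_of_lt hir, add_zero]
  exact (card_le_card hsub).trans
    ((card_union_le _ _).trans (Nat.add_le_add_left card_image_le _))

lemma Real.exp_sub_one_sub_id_le_of_abs_le_half {x : ℝ} (hx : |x| ≤ 1 / 2) :
    Real.exp x - 1 - x ≤ 2 / 3 * x ^ 2 := by
  have h := (abs_le.1 (Real.exp_bound (x := x) (n := 3) (by linarith) (by norm_num))).2
  simp only [sum_range_succ, sum_range_zero, Nat.factorial] at h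
  norm_num at h
  have h3 : |x| ^ 3 ≤ 1 / 2 * x ^ 2 := by
    rw [pow_succ, sq_abs, mul_comm]
    gcongr
  linarith [sq_nonneg x]

/-- A Chernoff bound, in counting form, for the number of coordinates equal to a given value. -/
lemma card_chernoff_le {ι : Type*} [Fintype ι] [DecidableEq ι] (b : ι) (m : ℕ) {l : ℝ}
    (hl : |l| ≤ 1 / 2) :
    (#{Z : Fin m → ι | l * (m / Fintype.card ι + l * (m / Fintype.card ι)) ≤
        l * (#{j | Z j = b} : ℝ)} : ℝ) ≤
      (Fintype.card ι : ℝ) ^ m * Real.exp (-(l ^ 2 / 3) * (m / Fintype.card ι)) := by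
  set K : ℝ := (Fintype.card ι : ℝ)
  have hK1 : 1 ≤ K := Nat.one_le_cast.2 (Fintype.card_pos_iff.2 ⟨b⟩)
  have hK : 0 < K := by linarith
  have hsum : ∑ Z : Fin m → ι, Real.exp (l * (#{j | Z j = b} : ℝ)) =
      (K + (Real.exp l - 1)) ^ m := by
    have hb : ∑ c : ι, Real.exp (if c = b then l else 0) = K + (Real.exp l - 1) := by
      have : ∀ c : ι, Real.exp (if c = b then l else 0) =
          1 + if c = b then Real.exp l - 1 else 0 := by
        intro c; split_ifs <;> simp
      simp [this, sum_add_distrib, K]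
    rw [← hb, Fintype.sum_pow]
    refine sum_congr rfl fun Z _ => ?_
    rw [← Real.exp_sum, ← sum_filter, sum_const, nsmul_eq_mul, mul_comm]
  have hle : (K + (Real.exp l - 1)) ^ m ≤ K ^ m * Real.exp ((Real.exp l - 1) * (m / K)) := by
    have h1 : K + (Real.exp l - 1) ≤ K * Real.exp ((Real.exp l - 1) / K) := by
      have := Real.add_one_le_exp ((Real.exp l - 1) / K)
      calc K + (Real.exp l - 1) = K * ((Real.exp l - 1) / K + 1) := by field_simp; ring
        _ ≤ _ := by gcongr
    have h0 : 0 ≤ K + (Real.exp l - 1) := by linarith [Real.exp_pos l]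
    calc (K + (Real.exp l - 1)) ^ m ≤ (K * Real.exp ((Real.exp l - 1) / K)) ^ m := by gcongr
      _ = _ := by
        rw [mul_pow, ← Real.exp_nat_mul]
        congr 2
        ring
  set c : ℝ := l * (m / K + l * (m / K)) with hc
  have hmarkov : (#{Z : Fin m → ι | c ≤ l * (#{j | Z j = b} : ℝ)} : ℝ) * Real.exp c ≤
      ∑ Z : Fin m → ι, Real.exp (l * (#{j | Z j = b} : ℝ)) := by
    rw [← nsmul_eq_mul]
    refine (card_nsmul_le_sum _ _ _ fun Z hZ => ?_).trans
      (sum_le_sum_of_subset_of_nonneg (filter_subset _ _) fun _ _ _ => (Real.exp_pos _).le)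
    exact Real.exp_le_exp.2 (mem_filter.1 hZ).2
  have hexp : (Real.exp l - 1) * (m / K) - c ≤ -(l ^ 2 / 3) * (m / K) := by
    have := Real.exp_sub_one_sub_id_le_of_abs_le_half hl
    have hm : (0 : ℝ) ≤ m / K := by positivity
    have := mul_le_mul_of_nonneg_right this hm
    rw [hc]
    linarith
  calc _ ≤ (∑ Z : Fin m → ι, Real.exp (l * (#{j | Z j = b} : ℝ))) / Real.exp c := by
        rwa [le_div_iff₀ (Real.exp_pos _)]
    _ ≤ K ^ m * Real.exp ((Real.exp l - 1) * (m / K)) / Real.exp c := by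
        gcongr
        exact hsum.trans_le hle
    _ = K ^ m * Real.exp ((Real.exp l - 1) * (m / K) - c) := by rw [Real.exp_sub]; ring
    _ ≤ _ := by gcongr

lemma card_abs_sub_ge_le {ι : Type*} [Fintype ι] [DecidableEq ι] (b : ι) (m : ℕ) {d : ℝ}
    (hd0 : 0 ≤ d) (hd : d ≤ 1 / 2) :
    (#{Z : Fin m → ι | d * (m / Fintype.card ι) ≤
        |(#{j | Z j = b} : ℝ) - m / Fintype.card ι|} : ℝ) ≤
      (Fintype.card ι : ℝ) ^ m * (2 * Real.exp (-(d ^ 2 / 3) * (m / Fintype.card ι))) := by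
  have h1 := card_chernoff_le b m (l := d) (by rwa [abs_of_nonneg hd0])
  have h2 := card_chernoff_le b m (l := -d) (by rwa [abs_neg, abs_of_nonneg hd0])
  rw [neg_sq] at h2
  refine le_trans ?_ ((add_le_add h1 h2).trans_eq (by ring))
  rw [← Nat.cast_add]
  refine Nat.cast_le.2 (le_trans (card_le_card fun Z hZ => ?_) (card_union_le _ _))
  simp only [mem_filter, mem_univ, true_and, mem_union] at hZ ⊢
  rcases le_abs.1 hZ with h | h
  · left; nlinarith
  · right; nlinarith

lemma card_blockHits_eq {k r m : ℕ} (w : Fin r → Fin k) (o : ℕ → Fin k)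
    (Z : Fin m → Fin r → Fin k) (h : ∀ j : Fin m, ∀ i : Fin r, o (j * r + i) = Z j i) :
    #(blockHits w m o) = #{j | Z j = w} := by
  symm
  refine card_bij (fun j _ => (j : ℕ)) ?_ (fun _ _ _ _ => Fin.ext) ?_
  · intro j hj
    rw [mem_filter] at hj
    simp [blockHits, h, hj.2]
  · intro j hj
    simp only [blockHits, mem_filter, mem_range] at hj
    refine ⟨⟨j, hj.1⟩, ?_, rfl⟩
    simp only [mem_filter, mem_univ, true_and]
    funext i
    rw [← h, ← hj.2 i]

lemma measurableSet_ESet {k : ℕ} (S : Shuffler k) (n : ℕ) (w : List (Fin k)) :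
    MeasurableSet (ESet S n w) := by
  have h := S.measurable_out n (Set.Finite.measurableSet
    (s := {z : Fin n → Fin k | |(alocc (List.ofFn z) w : ℝ) -
      (mnr n w.length : ℝ) / (k : ℝ) ^ w.length| < epsn k n * (mnr n w.length : ℝ)})
    (Set.toFinite _))
  exact h

lemma measure_blockHits_readAlong_le {k : ℕ} (hk : k ≠ 0) {ν : Measure (ℕ → Fin k)}
    (hν : IsUniformProductMeasure ν) (S : Shuffler k) (u v : List (Fin k)) {r : ℕ}
    (w : Fin r → Fin k) (m : ℕ) {d : ℝ} (hd0 : 0 ≤ d) (hd : d ≤ 1 / 2) :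
    ν.prod ν {p | d * (m / (k : ℝ) ^ r) ≤ |(#(blockHits w m
        (S.readAlong (overwrite u p.1) (overwrite v p.2) p.1 p.2)) : ℝ) - m / (k : ℝ) ^ r|} ≤
      ENNReal.ofReal (2 * Real.exp (-(d ^ 2 / 3) * (m / (k : ℝ) ^ r))) := by
  set bad : Finset (Fin m → Fin r → Fin k) :=
    {Z | d * (m / (k : ℝ) ^ r) ≤ |(#{j | Z j = w} : ℝ) - m / (k : ℝ) ^ r|} with hbad
  have hcard : (#bad : ℝ) ≤ ((k : ℝ) ^ r) ^ m *
      (2 * Real.exp (-(d ^ 2 / 3) * (m / (k : ℝ) ^ r))) := by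
    simpa using card_abs_sub_ge_le w m hd0 hd
  set word : (Fin m → Fin r → Fin k) → ℕ → Fin k := fun Z t =>
    if h : t / r < m ∧ t % r < r then Z ⟨t / r, h.1⟩ ⟨t % r, h.2⟩
    else ⟨0, Nat.pos_of_ne_zero hk⟩ with hword
  have hsub : {p : (ℕ → Fin k) × (ℕ → Fin k) | d * (m / (k : ℝ) ^ r) ≤ |(#(blockHits w m
        (S.readAlong (overwrite u p.1) (overwrite v p.2) p.1 p.2)) : ℝ) - m / (k : ℝ) ^ r|} ⊆
      ⋃ Z ∈ bad, {p | ∀ t < m * r,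
        S.readAlong (overwrite u p.1) (overwrite v p.2) p.1 p.2 t = word Z t} := by
    intro p hp
    set o := S.readAlong (overwrite u p.1) (overwrite v p.2) p.1 p.2
    simp only [Set.mem_iUnion]
    refine ⟨fun j i => o (j * r + i), ?_, ?_⟩
    · rw [hbad, mem_filter, ← card_blockHits_eq w o _ fun _ _ => rfl]
      exact ⟨mem_univ _, hp⟩
    · intro t ht
      have hr : 0 < r := Nat.pos_of_ne_zero (by rintro rfl; simp at ht)
      have h : t / r < m ∧ t % r < r := ⟨(Nat.div_lt_iff_lt_mul hr).2 ht, Nat.mod_lt _ hr⟩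
      simp only [hword, dif_pos h, Nat.div_add_mod']
      rfl
  have hkr : (0 : ℝ) < ((k : ℝ) ^ r) ^ m := by positivity
  calc _ ≤ ∑ Z ∈ bad, ν.prod ν {p | ∀ t < m * r,
        S.readAlong (overwrite u p.1) (overwrite v p.2) p.1 p.2 t = word Z t} :=
        (measure_mono hsub).trans (measure_biUnion_finset_le _ _)
    _ = ENNReal.ofReal (#bad * (((k : ℝ) ^ r) ^ m)⁻¹) := by
        simp only [S.measure_readAlong_prefix hk hν, sum_const, nsmul_eq_mul]
        rw [ENNReal.ofReal_mul (by positivity), ENNReal.ofReal_natCast,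
          ENNReal.ofReal_inv_of_pos hkr, ENNReal.ofReal_pow (by positivity),
          ENNReal.ofReal_pow (by positivity), ENNReal.ofReal_natCast, ENNReal.inv_pow, mul_comm m r,
          pow_mul, ENNReal.inv_pow]
    _ ≤ _ := by
        refine ENNReal.ofReal_le_ofReal ?_
        rw [← div_eq_mul_inv, div_le_iff₀ hkr, mul_comm]
        exact hcard

/-- conditional tail bound for a single aligned-block constraint
under conditioning on short fixed prefixes. -/
theorem stmt_4 (k : ℕ) (hk : 2 ≤ k) (n : ℕ) (hn : 3 ≤ n)
    (r : ℕ) (hr1 : 1 ≤ r) (hr2 : r ≤ elln k n)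
    (w : List (Fin k)) (hw : w.length = r) (S : Shuffler k)
    (L : ℕ) (u v : List (Fin k)) (hu : u.length = L) (hv : v.length = L)
    (ν : Measure (ℕ → Fin k)) (hν : IsUniformProductMeasure ν)
    (h4L : 4 * (L : ℝ) ≤ epsn k n * (mnr n r : ℝ))
    (hεk : epsn k n ≤ ((k : ℝ) ^ r)⁻¹) :
    ProbabilityTheory.cond (ν.prod ν) (cyl u ×ˢ cyl v) (ESet S n w)ᶜ
      ≤ ENNReal.ofReal
          (2 * Real.exp (-(epsn k n ^ 2 / 12) * (mnr n r : ℝ) * (k : ℝ) ^ r)) := by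
  subst hw
  set r := w.length
  set m := mnr n r
  set e := epsn k n with he
  have hk0 : k ≠ 0 := by omega
  have he0 : 0 ≤ e := by rw [he, epsn]; positivity
  have hK : (0 : ℝ) < (k : ℝ) ^ r := by positivity
  rw [cond_prod_cyl_eq_map hk0 hν, Measure.map_apply
    ((measurable_overwrite u).prodMap (measurable_overwrite v)) (measurableSet_ESet S n w).compl]
  have hd : e * (k : ℝ) ^ r / 2 ≤ 1 / 2 := by
    have := mul_le_mul_of_nonneg_right hεk hK.le
    rw [inv_mul_cancel₀ hK.ne'] at this
    linarith
  refine (measure_mono fun p hp => ?_).trans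
    ((measure_blockHits_readAlong_le hk0 hν S u v w.get m (by positivity) hd).trans_eq ?_)
  · have hp' : e * m ≤ |(alocc (wpre (S.out (overwrite u p.1) (overwrite v p.2)) n) w : ℝ) -
        m / (k : ℝ) ^ r| := not_lt.1 hp
    rw [alocc_wpre] at hp'
    set o := S.out (overwrite u p.1) (overwrite v p.2)
    set o' := S.readAlong (overwrite u p.1) (overwrite v p.2) p.1 p.2
    have hdiff : #{t ∈ range (m * r) | o t ≠ o' t} ≤ 2 * L := by
      have := S.card_out_ne_readAlong_le u v p.1 p.2 (m * r)
      rw [hu, hv, ← two_mul] at this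
      exact this
    have h1 : (#(blockHits w.get m o) : ℝ) ≤ #(blockHits w.get m o') + 2 * L := by
      exact_mod_cast (card_blockHits_le w.get m o o').trans (by gcongr)
    have h2 : (#(blockHits w.get m o') : ℝ) ≤ #(blockHits w.get m o) + 2 * L := by
      simp only [ne_comm (a := o _)] at hdiff
      exact_mod_cast (card_blockHits_le w.get m o' o).trans (by gcongr)
    have hdm : e * (k : ℝ) ^ r / 2 * (m / (k : ℝ) ^ r) = e * m / 2 := by field_simp
    change e * (k : ℝ) ^ r / 2 * (m / (k : ℝ) ^ r) ≤ |(#(blockHits w.get m o') : ℝ) - _|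
    change e * m ≤ |(#(blockHits w.get m o) : ℝ) - _| at hp'
    rw [hdm]
    rcases le_abs.1 hp' with h | h
    · exact le_abs.2 (.inl (by linarith))
    · exact le_abs.2 (.inr (by linarith))
  · congr 3
    field_simp
    ring
end

section
/- There exists n₀ ∈ ℕ (depending only on k) such that for every sequence (S_i)_{i≥1} of shufflers over Σ, all n ≥ n₀, every L ≤ √n, and all u, v ∈ Σ^L, we have B_n(u,v) ≤ 1/n². -/
open MeasureTheory Filter Finset
open scoped ENNReal ProbabilityTheory

/-- The average of `f` over all extensions of `o` by `T` further symbols. -/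
noncomputable def avgExt {k : ℕ} (f : List (Fin k) → ℝ≥0∞) : ℕ → List (Fin k) → ℝ≥0∞
  | 0, o => f o
  | T + 1, o => ∑ a, (k : ℝ≥0∞)⁻¹ * avgExt f T (o ++ [a])

lemma sum_inv_mul_const {k : ℕ} (hk : 0 < k) (x : ℝ≥0∞) :
    ∑ _a : Fin k, (k : ℝ≥0∞)⁻¹ * x = x := by
  rw [Finset.sum_const, Finset.card_univ, Fintype.card_fin, nsmul_eq_mul, ← mul_assoc,
    ENNReal.mul_inv_cancel (by exact_mod_cast hk.ne') (by simp), one_mul]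

lemma avgExt_add {k : ℕ} (f : List (Fin k) → ℝ≥0∞) (s T : ℕ) (o : List (Fin k)) :
    avgExt f (s + T) o = avgExt (avgExt f T) s o := by
  induction s generalizing o with
  | zero => simp [avgExt]
  | succ s ih => simp only [Nat.succ_add, avgExt, ih]

lemma avgExt_eq_sum {k : ℕ} (f : List (Fin k) → ℝ≥0∞) (T : ℕ) (o : List (Fin k)) :
    avgExt f T o = (k : ℝ≥0∞)⁻¹ ^ T * ∑ z : Fin T → Fin k, f (o ++ List.ofFn z) := by
  induction T generalizing o with
  | zero => simp [avgExt]
  | succ T ih =>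
    rw [avgExt, ← (Fin.consEquiv (fun _ : Fin (T + 1) => Fin k)).sum_comp,
      Fintype.sum_prod_type, Finset.mul_sum]
    refine Finset.sum_congr rfl fun a _ => ?_
    rw [ih, pow_succ', mul_assoc]
    simp [Fin.consEquiv, List.ofFn_succ]

lemma avgExt_le_of_replace {k : ℕ} {f : List (Fin k) → ℝ≥0∞} {K : ℝ≥0∞}
    (hf : ∀ o z a b, f (o ++ a :: z) ≤ K * f (o ++ b :: z)) (T : ℕ) (o z : List (Fin k))
    (a b : Fin k) : avgExt f T (o ++ a :: z) ≤ K * avgExt f T (o ++ b :: z) := by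
  induction T generalizing z with
  | zero => exact hf o z a b
  | succ T ih =>
    simp only [avgExt]
    rw [Finset.mul_sum]
    refine Finset.sum_le_sum fun c _ => ?_
    rw [mul_left_comm]
    gcongr
    simpa using ih (z ++ [c])

lemma avgExt_append_singleton_le {k : ℕ} {f : List (Fin k) → ℝ≥0∞} {K : ℝ≥0∞}
    (hf : ∀ o z a b, f (o ++ a :: z) ≤ K * f (o ++ b :: z)) (T : ℕ) (o : List (Fin k))
    (a : Fin k) : avgExt f T (o ++ [a]) ≤ K * avgExt f (T + 1) o := by
  rw [avgExt, Finset.mul_sum, ← sum_inv_mul_const a.pos (avgExt f T (o ++ [a]))]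
  refine Finset.sum_le_sum fun b _ => ?_
  rw [mul_left_comm]
  gcongr
  exact avgExt_le_of_replace hf T o [] a b

lemma wpre_succ {k : ℕ} (x : ℕ → Fin k) (n : ℕ) : wpre x (n + 1) = wpre x n ++ [x n] := by
  simp only [wpre, List.ofFn_succ', List.concat_eq_append]
  rfl

lemma mem_cyl_append_singleton {k : ℕ} {x : ℕ → Fin k} {p : List (Fin k)} {a : Fin k} :
    x ∈ cyl (p ++ [a]) ↔ x ∈ cyl p ∧ x p.length = a := by
  simp only [cyl, Set.mem_ofPred_eq, List.length_append, List.length_singleton, wpre_succ]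
  constructor
  · intro h
    have := List.append_inj' h rfl
    simpa using this
  · rintro ⟨h, h'⟩
    rw [h, h']

/-- One reading step: either a fresh uniform symbol is read, or one unit of the budget `K` is
spent. -/
lemma measure_inter_le_of_split {k : ℕ} {Ω : Type*} [MeasurableSpace Ω] (ρ : Measure Ω)
    (bad B : Set Ω) (A : Fin k → Set Ω) (hA : ∀ a, MeasurableSet (A a))
    (hdisj : Pairwise (Function.onFun Disjoint A)) (hB : B = ⋃ a, A a)
    (c K : ℝ≥0∞) (e e' : ℕ) (g : Fin k → ℝ≥0∞)
    (ih : ∀ a, c * ρ (A a ∩ bad) ≤ K ^ e' * g a * ρ (A a))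
    (h : (e' = e ∧ ∀ a, ρ (A a) = (k : ℝ≥0∞)⁻¹ * ρ B) ∨
      (e = e' + 1 ∧ ∀ a, g a ≤ K * ∑ b, (k : ℝ≥0∞)⁻¹ * g b)) :
    c * ρ (B ∩ bad) ≤ K ^ e * (∑ b, (k : ℝ≥0∞)⁻¹ * g b) * ρ B := by
  have h1 : c * ρ (B ∩ bad) ≤ ∑ a, K ^ e' * g a * ρ (A a) := by
    calc c * ρ (B ∩ bad) ≤ c * ∑ a, ρ (A a ∩ bad) := by
          gcongr
          rw [hB, Set.iUnion_inter]
          exact measure_iUnion_fintype_le ρ _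
      _ = ∑ a, c * ρ (A a ∩ bad) := Finset.mul_sum _ _ _
      _ ≤ _ := Finset.sum_le_sum fun a _ => ih a
  refine h1.trans ?_
  rcases h with ⟨rfl, h⟩ | ⟨rfl, h⟩
  · rw [Finset.mul_sum, Finset.sum_mul]
    refine Finset.sum_le_sum fun a _ => le_of_eq ?_
    rw [h]
    ring
  · have h2 : ρ B = ∑ a, ρ (A a) := by
      rw [hB, measure_iUnion hdisj hA, tsum_fintype]
    rw [h2, Finset.mul_sum]
    refine Finset.sum_le_sum fun a _ => ?_
    rw [pow_succ, mul_assoc (K ^ e') K]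
    gcongr
    exact h a

theorem Shuffler.measure_output_le {k : ℕ} (S : Shuffler k)
    (ρ : Measure ((ℕ → Fin k) × (ℕ → Fin k))) (L : ℕ)
    (hx : ∀ p q a, L ≤ p.length →
      ρ (cyl (p ++ [a]) ×ˢ cyl q) = (k : ℝ≥0∞)⁻¹ * ρ (cyl p ×ˢ cyl q))
    (hy : ∀ p q a, L ≤ q.length →
      ρ (cyl p ×ˢ cyl (q ++ [a])) = (k : ℝ≥0∞)⁻¹ * ρ (cyl p ×ˢ cyl q))
    {f : List (Fin k) → ℝ≥0∞} {K : ℝ≥0∞} (hK : 1 ≤ K)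
    (hf : ∀ o z a b, f (o ++ a :: z) ≤ K * f (o ++ b :: z)) (c : ℝ≥0∞)
    (T t : ℕ) (p q o : List (Fin k)) (s : Fin S.n)
    (hpq : ∀ x ∈ cyl p, ∀ y ∈ cyl q,
      S.conf x y t = (s, p.length, q.length) ∧ wpre (S.out x y) t = o) :
    c * ρ (cyl p ×ˢ cyl q ∩ {z | c ≤ f (wpre (S.out z.1 z.2) (t + T))}) ≤
      K ^ ((L - p.length) + (L - q.length)) * avgExt f T o * ρ (cyl p ×ˢ cyl q) := by
  induction T generalizing t p q o s with
  | zero =>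
    by_cases hc : c ≤ f o
    · rw [avgExt]
      gcongr
      · exact hc.trans (le_mul_of_one_le_left' (one_le_pow₀ hK))
      · exact Set.inter_subset_left
    · have : cyl p ×ˢ cyl q ∩ {z | c ≤ f (wpre (S.out z.1 z.2) (t + 0))} = ∅ := by
        ext ⟨x, y⟩
        simp only [Set.mem_inter_iff, Set.mem_prod, Set.mem_ofPred_eq, Set.mem_empty_iff_false,
          iff_false, not_and, and_imp, add_zero]
        intro h1 h2
        rwa [(hpq x h1 y h2).2]
      rw [this]
      simp
  | succ T ih =>
    rw [avgExt]
    cases hs : S.τ s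
    · refine measure_inter_le_of_split ρ _ _ (fun a => cyl p ×ˢ cyl (q ++ [a]))
        (fun a => (measurableSet_cyl _).prod (measurableSet_cyl _)) ?_ ?_ c K _
        ((L - p.length) + (L - (q.length + 1))) _ (fun a => ?_) ?_
      · intro a b hab
        rw [Function.onFun, Set.disjoint_left]
        rintro ⟨x, y⟩ ⟨_, h1⟩ ⟨_, h2⟩
        exact hab ((mem_cyl_append_singleton.1 h1).2.symm.trans (mem_cyl_append_singleton.1 h2).2)
      · ext ⟨x, y⟩
        simp [mem_cyl_append_singleton]
      · have := ih (t + 1) p (q ++ [a]) (o ++ [a]) (S.δ s a) (fun x h1 y h2 => by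
          rw [mem_cyl_append_singleton] at h2
          obtain ⟨h3, h4⟩ := hpq x h1 y h2.1
          have : S.out x y t = a := by simp [Shuffler.out, h3, hs, h2.2]
          rw [wpre_succ, h4, this]
          simp [Shuffler.conf, h3, hs, h2.2])
        rw [List.length_append, List.length_singleton, add_assoc t 1 T, add_comm 1 T] at this
        exact this
      · rcases le_or_gt L q.length with h | h
        · exact Or.inl ⟨by omega, fun a => hy p q a h⟩
        · exact Or.inr ⟨by omega, fun a => avgExt_append_singleton_le hf T o a⟩
    · refine measure_inter_le_of_split ρ _ _ (fun a => cyl (p ++ [a]) ×ˢ cyl q)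
        (fun a => (measurableSet_cyl _).prod (measurableSet_cyl _)) ?_ ?_ c K _
        ((L - (p.length + 1)) + (L - q.length)) _ (fun a => ?_) ?_
      · intro a b hab
        rw [Function.onFun, Set.disjoint_left]
        rintro ⟨x, y⟩ ⟨h1, _⟩ ⟨h2, _⟩
        exact hab ((mem_cyl_append_singleton.1 h1).2.symm.trans (mem_cyl_append_singleton.1 h2).2)
      · ext ⟨x, y⟩
        simp [mem_cyl_append_singleton]
      · have := ih (t + 1) (p ++ [a]) q (o ++ [a]) (S.δ s a) (fun x h1 y h2 => by
          rw [mem_cyl_append_singleton] at h1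
          obtain ⟨h3, h4⟩ := hpq x h1.1 y h2
          have : S.out x y t = a := by simp [Shuffler.out, h3, hs, h1.2]
          rw [wpre_succ, h4, this]
          simp [Shuffler.conf, h3, hs, h1.2])
        rw [List.length_append, List.length_singleton, add_assoc t 1 T, add_comm 1 T] at this
        exact this
      · rcases le_or_gt L p.length with h | h
        · exact Or.inl ⟨by omega, fun a => hx p q a h⟩
        · exact Or.inr ⟨by omega, fun a => avgExt_append_singleton_le hf T o a⟩

lemma alocc_append_cons_le {k : ℕ} (w o z : List (Fin k)) (a b : Fin k) :
    alocc (o ++ a :: z) w ≤ alocc (o ++ b :: z) w + 1 := by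
  rcases Nat.eq_zero_or_pos w.length with h0 | h0
  · simp [alocc, h0]
  refine (Finset.card_le_card (t := insert (o.length / w.length) _) fun j hj => ?_).trans
    (Finset.card_insert_le _ _)
  rw [Finset.mem_insert, or_iff_not_imp_left]
  intro hne
  rw [Finset.mem_filter] at hj ⊢
  refine ⟨by simpa using hj.1, ?_⟩
  refine Eq.trans ?_ hj.2
  refine List.ext_getElem? fun i => ?_
  simp only [List.getElem?_take, List.getElem?_drop]
  split_ifs with hi
  · have hne' : j * w.length + i ≠ o.length := by
      rintro h
      apply hne
      rw [← h, Nat.mul_comm, Nat.mul_add_div h0, Nat.div_eq_of_lt hi, add_zero]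
    rcases lt_or_gt_of_ne hne' with h | h
    · rw [List.getElem?_append_left h, List.getElem?_append_left h]
    · rw [List.getElem?_append_right h.le, List.getElem?_append_right h.le]
      obtain ⟨c, hc⟩ : ∃ c, j * w.length + i - o.length = c + 1 :=
        ⟨j * w.length + i - o.length - 1, by omega⟩
      rw [hc, List.getElem?_cons_succ, List.getElem?_cons_succ]
  · rfl

lemma alocc_append {k : ℕ} (w o z : List (Fin k)) (h : w.length ∣ o.length) :
    alocc (o ++ z) w = alocc o w + alocc z w := by
  rcases Nat.eq_zero_or_pos w.length with h0 | h0
  · simp [alocc, h0]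
  obtain ⟨j, hj⟩ := h
  simp only [alocc, Finset.card_filter, List.length_append]
  rw [hj, Nat.mul_add_div h0, Nat.mul_div_cancel_left _ h0, Finset.sum_range_add]
  congr 1
  · refine Finset.sum_congr rfl fun i hi => ?_
    have hi' : i * w.length + w.length ≤ o.length := by
      rw [hj, ← Nat.succ_mul, Nat.mul_comm]
      exact Nat.mul_le_mul_left _ (Finset.mem_range.1 hi)
    rw [List.drop_append_of_le_length (by omega), List.take_append_of_le_length]
    rw [List.length_drop]
    omega
  · refine Finset.sum_congr rfl fun i _ => ?_
    rw [add_mul, Nat.mul_comm j, ← hj, List.drop_append, List.drop_eq_nil_of_le (by omega),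
      Nat.add_sub_cancel_left, List.nil_append]

lemma alocc_eq_zero {k : ℕ} {w z : List (Fin k)} (h : z.length < w.length) : alocc z w = 0 := by
  simp [alocc, Nat.div_eq_of_lt h]

lemma alocc_of_length_eq {k : ℕ} {w z : List (Fin k)} (hw : 0 < w.length)
    (h : z.length = w.length) : alocc z w = if z = w then 1 else 0 := by
  simp only [alocc, h, Nat.div_self hw, Finset.card_filter, Finset.range_one,
    Finset.sum_singleton, zero_mul, List.drop_zero]
  rw [← h, List.take_length]

lemma avgExt_pow_alocc {k : ℕ} (w : List (Fin k)) (hw : 0 < w.length) (E : ℝ≥0∞) (m : ℕ)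
    (o : List (Fin k)) (ho : w.length ∣ o.length) :
    avgExt (fun z => E ^ alocc z w) (m * w.length) o =
      E ^ alocc o w * ((k : ℝ≥0∞)⁻¹ ^ w.length * ((k ^ w.length - 1 : ℕ) + E)) ^ m := by
  induction m generalizing o with
  | zero => simp [avgExt]
  | succ m ih =>
    rw [Nat.succ_mul, add_comm, avgExt_add, avgExt_eq_sum]
    have h1 : ∀ z : Fin w.length → Fin k,
        avgExt (fun z => E ^ alocc z w) (m * w.length) (o ++ List.ofFn z) =
          (if z = w.get then E else 1) * (E ^ alocc o w *
            ((k : ℝ≥0∞)⁻¹ ^ w.length * ((k ^ w.length - 1 : ℕ) + E)) ^ m) := by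
      intro z
      rw [ih _ (by simpa using ho), alocc_append _ _ _ ho, 
        alocc_of_length_eq (z := List.ofFn z) hw (by simp)]
      have : List.ofFn z = w ↔ z = w.get := by
        constructor
        · intro h
          apply List.ofFn_injective
          rw [h, List.ofFn_get]
        · rintro rfl
          exact List.ofFn_get w
      simp only [this]
      split_ifs <;> ring
    have h2 : ∑ z : Fin w.length → Fin k, (if z = w.get then E else 1) =
        ((k ^ w.length - 1 : ℕ) : ℝ≥0∞) + E := by
      rw [Finset.sum_ite]
      simp only [Finset.filter_eq', Finset.mem_univ, if_true, Finset.sum_const, nsmul_eq_mul, mul_one, Finset.filter_ne',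
        Finset.card_erase_of_mem (Finset.mem_univ _), Finset.card_univ]
      rw [add_comm]
      simp
    simp only [h1]
    rw [← Finset.sum_mul, h2]
    ring

lemma avgExt_pow_alocc_nil {k : ℕ} (hk : 0 < k) (w : List (Fin k)) (hw : 0 < w.length)
    (E : ℝ≥0∞) (n : ℕ) :
    avgExt (fun z => E ^ alocc z w) n [] =
      ((k : ℝ≥0∞)⁻¹ ^ w.length * ((k ^ w.length - 1 : ℕ) + E)) ^ (n / w.length) := by
  have h1 : ∀ o : List (Fin k), o.length = n / w.length * w.length →
      avgExt (fun z => E ^ alocc z w) (n % w.length) o = E ^ alocc o w := by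
    intro o ho
    rw [avgExt_eq_sum]
    have : ∀ z : Fin (n % w.length) → Fin k, alocc (o ++ List.ofFn z) w = alocc o w := by
      intro z
      rw [alocc_append _ _ _ (ho ▸ Nat.dvd_mul_left _ _),
        alocc_eq_zero (z := List.ofFn z) (by simpa using Nat.mod_lt _ hw), add_zero]
    simp only [this, Finset.sum_const, Finset.card_univ, Fintype.card_fun, Fintype.card_fin,
      nsmul_eq_mul]
    rw [← mul_assoc, Nat.cast_pow, ← mul_pow,
      ENNReal.inv_mul_cancel (by exact_mod_cast hk.ne') (by simp), one_pow, one_mul]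
  have h2 := avgExt_pow_alocc w hw E (n / w.length) [] (by simp)
  conv_lhs => rw [← Nat.div_add_mod' n w.length]
  rw [avgExt_add, avgExt_eq_sum]
  rw [avgExt_eq_sum] at h2
  simp only [List.nil_append] at h2 ⊢
  have h3 : alocc ([] : List (Fin k)) w = 0 := alocc_eq_zero (by simpa using hw)
  rw [h3, pow_zero, one_mul] at h2
  rw [← h2]
  congr 1
  refine Finset.sum_congr rfl fun z _ => h1 _ (by simp)

/-- Hoeffding's lemma for a Bernoulli variable. -/
lemma bernoulli_mgf_le {p : ℝ} (hp0 : 0 ≤ p) (hp1 : p ≤ 1) (θ : ℝ) :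
    1 - p + p * Real.exp θ ≤ Real.exp (θ * p + θ ^ 2 / 8) := by
  have h := (ProbabilityTheory.hasSubgaussianMGF_of_mem_Icc
    (μ := ProbabilityTheory.bernoulliMeasure (1 : ℝ) 0 ⟨p, hp0, hp1⟩) (X := id) (a := 0) (b := 1)
    aemeasurable_id (by
      rw [ProbabilityTheory.bernoulliMeasure_def, ae_iff]
      simp)).mgf_le θ
  rw [ProbabilityTheory.mgf] at h
  simp only [ProbabilityTheory.integral_bernoulliMeasure] at h
  norm_num at h
  have h2 := mul_le_mul_of_nonneg_left h (Real.exp_pos (θ * p)).le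
  rw [← Real.exp_add, mul_add, mul_left_comm, ← Real.exp_add, mul_left_comm _ (1 - p),
    ← Real.exp_add] at h2
  calc _ = _ := ?_
    _ ≤ _ := h2
    _ = _ := ?_
  · rw [show θ * p + θ * (1 - p) = θ by ring, show θ * p + -(θ * p) = 0 by ring, Real.exp_zero]
    ring
  · congr 1
    ring

theorem Shuffler.exp_tail_le {k : ℕ} (hk : 0 < k) (S : Shuffler k)
    (ρ : Measure ((ℕ → Fin k) × (ℕ → Fin k))) [IsProbabilityMeasure ρ] (L : ℕ)
    (hx : ∀ p q a, L ≤ p.length →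
      ρ (cyl (p ++ [a]) ×ˢ cyl q) = (k : ℝ≥0∞)⁻¹ * ρ (cyl p ×ˢ cyl q))
    (hy : ∀ p q a, L ≤ q.length →
      ρ (cyl p ×ˢ cyl (q ++ [a])) = (k : ℝ≥0∞)⁻¹ * ρ (cyl p ×ˢ cyl q))
    (w : List (Fin k)) (hw : 0 < w.length) (n : ℕ) (θ X : ℝ) :
    ρ {z | θ * X ≤ θ * alocc (wpre (S.out z.1 z.2) n) w} ≤
      ENNReal.ofReal (Real.exp (2 * L * |θ| + mnr n w.length *
        (θ / (k : ℝ) ^ w.length + θ ^ 2 / 8) - θ * X)) := by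
  have hpow : ∀ (x : ℝ) (j : ℕ), ENNReal.ofReal (Real.exp x) ^ j =
      ENNReal.ofReal (Real.exp (x * j)) := by
    intro x j
    rw [← ENNReal.ofReal_pow (Real.exp_pos _).le, ← Real.exp_nat_mul, mul_comm]
  have hmul : ∀ x y : ℝ, ENNReal.ofReal (Real.exp x) * ENNReal.ofReal (Real.exp y) =
      ENNReal.ofReal (Real.exp (x + y)) := by
    intro x y
    rw [← ENNReal.ofReal_mul (Real.exp_pos _).le, ← Real.exp_add]
  have hle : ∀ {x y : ℝ}, x ≤ y →
      ENNReal.ofReal (Real.exp x) ≤ ENNReal.ofReal (Real.exp y) := fun h =>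
    ENNReal.ofReal_le_ofReal (Real.exp_le_exp.2 h)
  have key := S.measure_output_le ρ L hx hy
    (f := fun z => ENNReal.ofReal (Real.exp θ) ^ alocc z w)
    (K := ENNReal.ofReal (Real.exp |θ|)) (by simp) (by
      intro o z a b
      simp only [hpow, hmul]
      apply hle
      have h1 : (alocc (o ++ a :: z) w : ℝ) ≤ alocc (o ++ b :: z) w + 1 := by
        exact_mod_cast alocc_append_cons_le w o z a b
      have h2 : (alocc (o ++ b :: z) w : ℝ) ≤ alocc (o ++ a :: z) w + 1 := by
        exact_mod_cast alocc_append_cons_le w o z b a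
      rcases abs_cases θ with ⟨h, h'⟩ | ⟨h, h'⟩ <;> rw [h] <;> nlinarith)
    (ENNReal.ofReal (Real.exp (θ * X))) n 0 [] [] [] S.q0 (by simp [Shuffler.conf, wpre])
  have hcyl : cyl ([] : List (Fin k)) = Set.univ := by
    ext
    simp [cyl, wpre]
  have hM : (k : ℝ≥0∞)⁻¹ ^ w.length *
      (((k ^ w.length - 1 : ℕ) : ℝ≥0∞) + ENNReal.ofReal (Real.exp θ)) ≤
        ENNReal.ofReal (Real.exp (θ / (k : ℝ) ^ w.length + θ ^ 2 / 8)) := by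
    have hk1 : (1 : ℝ) ≤ (k : ℝ) ^ w.length := one_le_pow₀ (by exact_mod_cast hk)
    have hb := bernoulli_mgf_le (p := ((k : ℝ) ^ w.length)⁻¹) (by positivity)
      (inv_le_one_of_one_le₀ hk1) θ
    rw [← div_eq_mul_inv] at hb
    refine le_trans (le_of_eq ?_) (ENNReal.ofReal_le_ofReal hb)
    rw [← ENNReal.ofReal_natCast k, ← ENNReal.ofReal_natCast (k ^ w.length - 1),
      ← ENNReal.ofReal_inv_of_pos (by exact_mod_cast hk), ← ENNReal.ofReal_pow (by positivity),
      ← ENNReal.ofReal_add (by positivity) (by positivity),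
      ← ENNReal.ofReal_mul (by positivity)]
    congr 1
    rw [Nat.cast_sub (Nat.one_le_pow _ _ hk), inv_pow]
    push_cast
    field_simp
  rw [avgExt_pow_alocc_nil hk w hw] at key
  simp only [hcyl, Set.univ_prod_univ, measure_univ, mul_one, Set.univ_inter, List.length_nil,
    Nat.sub_zero, zero_add, hpow] at key
  have hset : {z : (ℕ → Fin k) × (ℕ → Fin k) | ENNReal.ofReal (Real.exp (θ * X)) ≤
      ENNReal.ofReal (Real.exp (θ * alocc (wpre (S.out z.1 z.2) n) w))} =
      {z | θ * X ≤ θ * alocc (wpre (S.out z.1 z.2) n) w} := by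
    ext z
    simp [ENNReal.ofReal_le_ofReal_iff (Real.exp_pos _).le]
  rw [hset] at key
  replace key := mul_le_mul_right key (ENNReal.ofReal (Real.exp (-(θ * X))))
  rw [← mul_assoc, hmul, neg_add_cancel, Real.exp_zero, ENNReal.ofReal_one, one_mul] at key
  refine key.trans ((mul_le_mul_right (mul_le_mul_right (pow_le_pow_left' hM _) _) _).trans ?_)
  rw [hpow, hmul, hmul]
  apply hle
  rw [mnr]
  push_cast
  linarith

lemma cyl_inter_eq {k : ℕ} {u p : List (Fin k)} (h : u.length ≤ p.length) :
    cyl u ∩ cyl p = if p.take u.length = u then cyl p else ∅ := by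
  have h1 : ∀ x : ℕ → Fin k, wpre x u.length = (wpre x p.length).take u.length := by
    intro x
    apply List.ext_getElem
    · simp [wpre, h]
    · simp [wpre]
  ext x
  simp only [cyl, Set.mem_inter_iff, Set.mem_ofPred_eq]
  split_ifs with hp
  · simp only [Set.mem_ofPred_eq, and_iff_right_iff_imp]
    intro hx
    rw [h1, hx, hp]
  · simp only [Set.mem_empty_iff_false, iff_false, not_and]
    intro hx hx'
    rw [h1, hx'] at hx
    exact hp hx

lemma IsUniformProductMeasure.measure_cyl_inter_append {k : ℕ} {ν : Measure (ℕ → Fin k)}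
    (hν : IsUniformProductMeasure ν) {u p : List (Fin k)} (h : u.length ≤ p.length)
    (a : Fin k) : ν (cyl u ∩ cyl (p ++ [a])) = (k : ℝ≥0∞)⁻¹ * ν (cyl u ∩ cyl p) := by
  rw [cyl_inter_eq h, cyl_inter_eq (h.trans (by simp)), List.take_append_of_le_length h]
  split_ifs
  · rw [hν.2, hν.2, List.length_append, List.length_singleton, pow_succ']
  · simp

lemma elln_log_le {k n : ℕ} (hk : 2 ≤ k) (hn : 1 ≤ n) :
    3 * (elln k n : ℝ) * Real.log k ≤ Real.log n := by
  have hc : 0 < Real.log k := Real.log_pos (by exact_mod_cast hk)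
  have hl : 0 ≤ Real.log n := Real.log_nonneg (by exact_mod_cast hn)
  have h := Nat.floor_le (a := Real.logb k n / 3) (by rw [Real.logb]; positivity)
  rw [← elln, Real.logb, div_div, le_div_iff₀ (by positivity)] at h
  linarith

lemma pow_elln_le {k n : ℕ} (hk : 2 ≤ k) (hn : 1 ≤ n) : k ^ (3 * elln k n) ≤ n := by
  have h := elln_log_le hk hn
  have h2 : Real.log ((k : ℝ) ^ (3 * elln k n)) ≤ Real.log n := by
    rw [Real.log_pow]
    push_cast
    exact h
  have h3 := (Real.log_le_log_iff (by positivity) (by positivity)).1 h2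
  exact_mod_cast h3

lemma epsn_sq {k n : ℕ} (hk : 2 ≤ k) :
    epsn k n ^ 2 = 4 * (Real.log n ^ 2 / (Real.log k * n)) := by
  have hc : 0 < Real.log k := Real.log_pos (by exact_mod_cast hk)
  rw [epsn, mul_pow, Real.logb, show Real.log n * (Real.log n / Real.log k) / n =
    Real.log n ^ 2 / (Real.log k * n) by field_simp, Real.sq_sqrt (by positivity)]
  norm_num

lemma log_mul_mnr_ge {k n r : ℕ} (hk : 2 ≤ k) (hn : 1 ≤ n) (hr1 : 1 ≤ r) (hr : r ≤ elln k n) :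
    5 / 2 * Real.log k * n ≤ Real.log n * mnr n r := by
  have hc : 0 < Real.log k := Real.log_pos (by exact_mod_cast hk)
  have hrn : 6 * r ≤ n := by
    have h1 : 2 ^ (3 * elln k n) ≤ n := (Nat.pow_le_pow_left hk _).trans (pow_elln_le hk hn)
    have h2 : 6 * elln k n ≤ 2 ^ (3 * elln k n) := by
      obtain ⟨e, he⟩ : ∃ e, elln k n = e + 1 := ⟨elln k n - 1, by omega⟩
      rw [he, pow_mul]
      clear * -
      induction e with
      | zero => norm_num
      | succ e ih => rw [pow_succ]; omega
    omega
  have hm : (5 / 6 : ℝ) * n ≤ r * mnr n r := by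
    have h1 : n < r * mnr n r + r := by
      have := Nat.div_add_mod n r
      have := Nat.mod_lt n hr1
      rw [mnr]
      omega
    have h2 : (n : ℝ) < r * mnr n r + r := by exact_mod_cast h1
    have h3 : (6 : ℝ) * r ≤ n := by exact_mod_cast hrn
    linarith
  have hl : 3 * (r : ℝ) * Real.log k ≤ Real.log n := by
    refine le_trans ?_ (elln_log_le hk hn)
    gcongr
  have hm0 : (0 : ℝ) ≤ mnr n r := Nat.cast_nonneg _
  calc 5 / 2 * Real.log k * n = 3 * Real.log k * (5 / 6 * n) := by ring
    _ ≤ 3 * Real.log k * (r * mnr n r) := by gcongr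
    _ = 3 * r * Real.log k * mnr n r := by ring
    _ ≤ _ := by gcongr

lemma epsn_sq_mul_mnr_ge {k n r : ℕ} (hk : 2 ≤ k) (hn : 1 ≤ n) (hr1 : 1 ≤ r)
    (hr : r ≤ elln k n) : 10 * Real.log n ≤ epsn k n ^ 2 * mnr n r := by
  have hc : 0 < Real.log k := Real.log_pos (by exact_mod_cast hk)
  have hl : 0 ≤ Real.log n := Real.log_nonneg (by exact_mod_cast hn)
  have h := mul_le_mul_of_nonneg_left (log_mul_mnr_ge hk hn hr1 hr) hl
  have hn0 : (0 : ℝ) < n := by exact_mod_cast hn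
  rw [epsn_sq hk, mul_assoc, div_mul_eq_mul_div, mul_div_assoc', le_div_iff₀ (by positivity)]
  linarith

lemma sqrt_le_epsn_mul_mnr {k n r : ℕ} (hk : 2 ≤ k) (hn : 1 ≤ n) (hr1 : 1 ≤ r)
    (hr : r ≤ elln k n) : 4 * Real.sqrt n ≤ epsn k n * mnr n r := by
  have hc : 0 < Real.log k := Real.log_pos (by exact_mod_cast hk)
  have hc2 : 0.64 ≤ Real.log k := by
    have h1 : Real.log 2 ≤ Real.log k := Real.log_le_log (by norm_num) (by exact_mod_cast hk)
    have := Real.log_two_gt_d9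
    linarith
  have hn0 : (0 : ℝ) < n := by exact_mod_cast hn
  have h := pow_le_pow_left₀ (by positivity) (log_mul_mnr_ge hk hn hr1 hr) 2
  have he : 0 ≤ epsn k n := by rw [epsn]; positivity
  refine le_of_sq_le_sq ?_ (by positivity)
  rw [mul_pow, Real.sq_sqrt hn0.le, mul_pow, epsn_sq hk, mul_assoc, div_mul_eq_mul_div,
    mul_div_assoc', le_div_iff₀ (by positivity)]
  have h2 : 0.64 * (Real.log k * n ^ 2) ≤ Real.log k * (Real.log k * n ^ 2) := by gcongr
  nlinarith

theorem Shuffler.measure_compl_ESet_le {k : ℕ} (hk : 2 ≤ k) (S : Shuffler k)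
    {ν : Measure (ℕ → Fin k)} (hν : IsUniformProductMeasure ν) {n L : ℕ} (hn : 1 ≤ n)
    (hL : (L : ℝ) ≤ Real.sqrt n) {u v : List (Fin k)} (hu : u.length = L) (hv : v.length = L)
    (w : List (Fin k)) (hw1 : 1 ≤ w.length) (hw : w.length ≤ elln k n) :
    ProbabilityTheory.cond (ν.prod ν) (cyl u ×ˢ cyl v) (ESet S n w)ᶜ ≤
      ENNReal.ofReal (2 / (n : ℝ) ^ 5) := by
  have := hν.1
  have hs : MeasurableSet (cyl u ×ˢ cyl v) := (measurableSet_cyl u).prod (measurableSet_cyl v)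
  have hs0 : (ν.prod ν) (cyl u ×ˢ cyl v) ≠ 0 := by
    rw [Measure.prod_prod, hν.2, hν.2]
    simp
  have : IsProbabilityMeasure (ProbabilityTheory.cond (ν.prod ν) (cyl u ×ˢ cyl v)) :=
    ProbabilityTheory.cond_isProbabilityMeasure hs0
  set ρ := ProbabilityTheory.cond (ν.prod ν) (cyl u ×ˢ cyl v) with hρ
  have hρapp : ∀ p q, ρ (cyl p ×ˢ cyl q) = ((ν.prod ν) (cyl u ×ˢ cyl v))⁻¹ *
      (ν (cyl u ∩ cyl p) * ν (cyl v ∩ cyl q)) := by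
    intro p q
    rw [hρ, ProbabilityTheory.cond_apply hs, Set.prod_inter_prod, Measure.prod_prod (cyl u ∩ _)]
  have tail := S.exp_tail_le (by omega) ρ L
    (fun p q a h => by
      rw [hρapp, hρapp, hν.measure_cyl_inter_append (by omega)]
      ring)
    (fun p q a h => by
      rw [hρapp, hρapp, hν.measure_cyl_inter_append (by omega)]
      ring) w hw1 n
  set m : ℝ := (mnr n w.length : ℝ)
  set ε := epsn k n with hε
  set P : ℝ := (k : ℝ) ^ w.length
  have he : 0 ≤ ε := by rw [hε, epsn]; positivity
  have h1 : 10 * Real.log n ≤ ε ^ 2 * m := epsn_sq_mul_mnr_ge hk hn hw1 hw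
  have h2 : 4 * Real.sqrt n ≤ ε * m := sqrt_le_epsn_mul_mnr hk hn hw1 hw
  have hLe : 4 * L * ε ≤ ε * m * ε := mul_le_mul_of_nonneg_right (by linarith) he
  have hexp : Real.exp (-(5 * Real.log n)) = 1 / (n : ℝ) ^ 5 := by
    have hn0 : (0 : ℝ) < n := by exact_mod_cast hn
    rw [Real.exp_neg, show (5 : ℝ) * Real.log n = ((5 : ℕ) : ℝ) * Real.log n by norm_num,
      Real.exp_nat_mul, Real.exp_log hn0, one_div]
  have hup : ρ {z | 2 * ε * (m / P + ε * m) ≤ 2 * ε * alocc (wpre (S.out z.1 z.2) n) w} ≤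
      ENNReal.ofReal (1 / (n : ℝ) ^ 5) := by
    refine (tail _ _).trans (ENNReal.ofReal_le_ofReal ?_)
    rw [← hexp, abs_of_nonneg (by positivity)]
    refine Real.exp_le_exp.2 ?_
    linear_combination hLe + h1 / 2
  have hlow : ρ {z | -(2 * ε) * (m / P - ε * m) ≤
      -(2 * ε) * alocc (wpre (S.out z.1 z.2) n) w} ≤ ENNReal.ofReal (1 / (n : ℝ) ^ 5) := by
    refine (tail _ _).trans (ENNReal.ofReal_le_ofReal ?_)
    rw [← hexp, abs_neg, abs_of_nonneg (by positivity)]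
    refine Real.exp_le_exp.2 ?_
    linear_combination hLe + h1 / 2
  have hsub : (ESet S n w)ᶜ ⊆
      {z | 2 * ε * (m / P + ε * m) ≤ 2 * ε * alocc (wpre (S.out z.1 z.2) n) w} ∪
      {z | -(2 * ε) * (m / P - ε * m) ≤ -(2 * ε) * alocc (wpre (S.out z.1 z.2) n) w} := by
    intro z hz
    simp only [ESet, Set.mem_compl_iff, Set.mem_ofPred_eq, not_lt] at hz
    change ε * m ≤ |(alocc (wpre (S.out z.1 z.2) n) w : ℝ) - m / P| at hz
    rcases le_abs.1 hz with h | h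
    · left
      rw [Set.mem_ofPred_eq]
      exact mul_le_mul_of_nonneg_left (by linarith) (by positivity)
    · right
      rw [Set.mem_ofPred_eq]
      exact mul_le_mul_of_nonpos_left (by linarith) (by linarith)
  calc ρ (ESet S n w)ᶜ ≤ _ := measure_mono hsub
    _ ≤ _ := measure_union_le _ _
    _ ≤ _ := add_le_add hup hlow
    _ = _ := by
      rw [← ENNReal.ofReal_add (by positivity) (by positivity)]
      congr 1
      ring

/-- there is `n₀` (depending only on `k`) such that for prefixes of
length `L ≤ √n` the total conditional bad mass satisfies `B_n(u,v) ≤ 1/n²`. -/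
theorem stmt_5 (k : ℕ) (hk : 2 ≤ k) :
    ∃ n₀ : ℕ, ∀ (S : ℕ → Shuffler k) (ν : Measure (ℕ → Fin k)),
      IsUniformProductMeasure ν →
      ∀ n : ℕ, n₀ ≤ n → ∀ L : ℕ, (L : ℝ) ≤ Real.sqrt n →
      ∀ u v : List (Fin k), u.length = L → v.length = L →
        Bn (ν.prod ν) S n u v ≤ (1 : ℝ≥0∞) / (n : ℝ≥0∞) ^ 2 := by
  refine ⟨1, fun S ν hν n hn L hL u v hu hv => ?_⟩
  set e := elln k n with he
  set d := ENNReal.ofReal (2 / (n : ℝ) ^ 5)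
  have hsum : Bn (ν.prod ν) S n u v ≤ n • e • (k ^ e) • d := by
    rw [Bn]
    refine (Finset.sum_le_card_nsmul _ _ (e • (k ^ e) • d) fun i _ => ?_).trans_eq (by simp)
    refine (Finset.sum_le_card_nsmul _ _ ((k ^ e) • d) fun r hr => ?_).trans_eq
      (by simp [← he])
    obtain ⟨hr1, hr2⟩ := Finset.mem_Icc.1 hr
    refine (Finset.sum_le_card_nsmul _ _ d fun w _ => ?_).trans ?_
    · exact (S i).measure_compl_ESet_le hk hν hn hL hu hv _ (by simpa using hr1)
        (by simpa using hr2)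
    · rw [Finset.card_univ, Fintype.card_fun, Fintype.card_fin, Fintype.card_fin]
      exact nsmul_le_nsmul_left zero_le (Nat.pow_le_pow_right (by omega) hr2)
  have hcount : 2 * (e * k ^ e) ≤ n := by
    refine le_trans ?_ (pow_elln_le hk hn)
    rw [← he, show 3 * e = (e + e) + e by ring, pow_add k (e + e), ← mul_assoc]
    gcongr
    refine le_trans ?_ (Nat.pow_le_pow_left hk _)
    rw [← two_mul, pow_mul]
    clear * -
    induction e with
    | zero => norm_num
    | succ e ih => rw [pow_succ]; have := Nat.one_le_pow e (2 ^ 2) (by norm_num); omega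
  refine hsum.trans ?_
  have hn0 : (0 : ℝ) < n := by exact_mod_cast hn
  have hcount' : 2 * ((e : ℝ) * (k : ℝ) ^ e) ≤ n := by exact_mod_cast hcount
  rw [← ENNReal.ofReal_nsmul, ← ENNReal.ofReal_nsmul, ← ENNReal.ofReal_nsmul,
    show (1 : ℝ≥0∞) / (n : ℝ≥0∞) ^ 2 = ENNReal.ofReal (1 / (n : ℝ) ^ 2) by
      rw [ENNReal.ofReal_div_of_pos (by positivity), ENNReal.ofReal_pow hn0.le]
      simp]
  refine ENNReal.ofReal_le_ofReal ?_
  simp only [nsmul_eq_mul, Nat.cast_pow]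
  calc (n : ℝ) * (e * ((k : ℝ) ^ e * (2 / (n : ℝ) ^ 5)))
      = 2 * (e * (k : ℝ) ^ e) * (n / (n : ℝ) ^ 5) := by ring
    _ ≤ n * (n / (n : ℝ) ^ 5) := by gcongr
    _ = 1 / (n : ℝ) ^ 3 := by field_simp
    _ ≤ 1 / (n : ℝ) ^ 2 := by
      gcongr
      · exact_mod_cast hn
      · norm_num
end

section
/- Let (S_i)_{i≥1} be a sequence of shufflers over Σ in which every shuffler over Σ occurs, fix a constant m₀ ∈ ℕ, and set N_j := (j+m₀)^4. Suppose x, y ∈ Σ^∞ satisfy (x,y) ∈ F_{N_j} for every j ≥ 1. Then for every shuffler S over Σ, the output S(x,y) is normal; in particular x and y are normal. -/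
open MeasureTheory Filter Finset
open scoped ENNReal ProbabilityTheory

/-- The length-`m` window of the infinite word `z` starting at position `t`. -/
def window {k : ℕ} (z : ℕ → Fin k) (m t : ℕ) : Fin m → Fin k := fun i => z (t + i)

/-- The number of occurrences of `w` in `z` starting before position `n`. -/
def startCount {k m : ℕ} (z : ℕ → Fin k) (w : Fin m → Fin k) (n : ℕ) : ℕ :=
  #{t ∈ range n | window z m t = w}

theorem take_drop_wpre_eq_iff {k m : ℕ} (z : ℕ → Fin k) (w : Fin m → Fin k) {n t : ℕ}
    (h : t + m ≤ n) :
    ((wpre z n).drop t).take m = List.ofFn w ↔ window z m t = w := by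
  have key : ((wpre z n).drop t).take m = List.ofFn (window z m t) := by
    apply List.ext_getElem
    · simp [wpre]; omega
    · intro i h1 h2
      simp [wpre, window]
  rw [key, List.ofFn_inj]

theorem alocc_wpre_ofFn {k r : ℕ} (z : ℕ → Fin k) (v : Fin r → Fin k) (n : ℕ) :
    alocc (wpre z n) (List.ofFn v) = #{j ∈ range (n / r) | window z r (j * r) = v} := by
  have hl : (wpre z n).length = n := by simp [wpre]
  simp only [alocc, List.length_ofFn, hl]
  congr 1
  refine filter_congr fun j hj => take_drop_wpre_eq_iff z v ?_
  have h1 : j + 1 ≤ n / r := by simpa using hj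
  calc j * r + r = (j + 1) * r := by ring
    _ ≤ n / r * r := Nat.mul_le_mul_right _ h1
    _ ≤ n := Nat.div_mul_le_self n r

theorem occ_wpre_ofFn {k m : ℕ} (z : ℕ → Fin k) (w : Fin m → Fin k) (n : ℕ) :
    occ (wpre z n) (List.ofFn w) = startCount z w (n + 1 - m) := by
  have hl : (wpre z n).length = n := by simp [wpre]
  simp only [occ, List.length_ofFn, hl, startCount]
  congr 1
  refine filter_congr fun t ht => take_drop_wpre_eq_iff z w ?_
  have := mem_range.1 ht
  omega

theorem startCount_mono {k m : ℕ} (z : ℕ → Fin k) (w : Fin m → Fin k) :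
    Monotone (startCount z w) := fun a b hab => by
  unfold startCount
  gcongr

theorem startCount_add_le {k m : ℕ} (z : ℕ → Fin k) (w : Fin m → Fin k) (a b : ℕ) :
    startCount z w (a + b) ≤ startCount z w a + b := by
  induction b with
  | zero => simp
  | succ b ih =>
    have : startCount z w (a + b + 1) ≤ startCount z w (a + b) + 1 := by
      unfold startCount
      rw [range_add_one, filter_insert]
      split_ifs
      · exact card_insert_le _ _
      · omega
    rw [← add_assoc]
    omega

theorem sum_startCount {k m : ℕ} (z : ℕ → Fin k) (n : ℕ) :
    ∑ w : Fin m → Fin k, startCount z w n = n := by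
  have := card_eq_sum_card_fiberwise (s := range n) (t := (univ : Finset (Fin m → Fin k)))
    (f := window z m) (fun _ _ => by simp)
  simpa [startCount] using this.symm

/-- The number of words of length `r` which carry a given word of length `m` at offset `s`. -/
theorem card_filter_window_eq {k m r s : ℕ} (w : Fin m → Fin k) (h : s + m ≤ r) :
    #{v : Fin r → Fin k | ∀ i : Fin m, v ⟨s + i, by omega⟩ = w i} = k ^ (r - m) := by
  classical
  have e : (univ.filter fun v : Fin r → Fin k => ∀ i : Fin m, v ⟨s + i, by omega⟩ = w i) =
      Fintype.piFinset fun p : Fin r =>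
        if hp : s ≤ p ∧ (p : ℕ) < s + m then {w ⟨p - s, by omega⟩} else univ := by
    ext v
    simp only [mem_filter, mem_univ, true_and, Fintype.mem_piFinset]
    constructor
    · intro hv p
      split_ifs with hp
      · rw [mem_singleton, ← hv]
        congr 1
        ext
        simp
        omega
      · simp
    · intro hv i
      have := hv ⟨s + i, by omega⟩
      rw [dif_pos ⟨by simp, by simp⟩] at this
      simpa using this
  have hc : #{p : Fin r | s ≤ p ∧ (p : ℕ) < s + m} = m := by
    have : (univ.filter fun p : Fin r => s ≤ p ∧ (p : ℕ) < s + m).map Fin.valEmbedding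
        = Ico s (s + m) := by
      ext a
      simp only [Finset.mem_map, mem_filter, mem_univ, true_and, Fin.valEmbedding_apply, mem_Ico]
      exact ⟨by rintro ⟨p, hp, rfl⟩; exact hp, fun ha => ⟨⟨a, by omega⟩, ha, rfl⟩⟩
    rw [← card_map Fin.valEmbedding, this]
    simp
  rw [e, Fintype.card_piFinset]
  have h2 : ∀ p : Fin r, #(if hp : s ≤ p ∧ (p : ℕ) < s + m then
      ({w ⟨p - s, by omega⟩} : Finset (Fin k)) else univ) =
      if s ≤ p ∧ (p : ℕ) < s + m then 1 else k := by
    intro p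
    split_ifs <;> simp
  simp_rw [h2]
  rw [prod_ite, prod_const_one, one_mul, prod_const]
  congr 1
  have := card_filter_add_card_filter_not (s := (univ : Finset (Fin r)))
    (fun p : Fin r => s ≤ p ∧ (p : ℕ) < s + m)
  rw [hc, card_univ, Fintype.card_fin] at this
  omega

theorem sum_aligned_eq {k m r s : ℕ} (z : ℕ → Fin k) (w : Fin m → Fin k) (h : s + m ≤ r)
    (M : ℕ) :
    ∑ v : Fin r → Fin k with ∀ i : Fin m, v ⟨s + i, by omega⟩ = w i,
        #{j ∈ range M | window z r (j * r) = v} =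
      #{j ∈ range M | window z m (j * r + s) = w} := by
  have hw : ∀ j, window z m (j * r + s) = w ↔
      ∀ i : Fin m, window z r (j * r) ⟨s + i, by omega⟩ = w i := fun j => by
    simp [funext_iff, window, add_assoc]
  rw [card_eq_sum_card_fiberwise (f := fun j => window z r (j * r))
    (t := univ.filter fun v : Fin r → Fin k => ∀ i : Fin m, v ⟨s + i, by omega⟩ = w i)]
  · refine sum_congr rfl fun v hv => ?_
    rw [filter_filter]
    congr 1
    refine filter_congr fun j _ => ?_
    rw [hw]
    constructor
    · rintro rfl
      exact ⟨(mem_filter.1 hv).2, rfl⟩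
    · exact fun h => h.2
  · intro j hj
    simp only [coe_filter, Set.mem_ofPred_eq, mem_range, mem_univ, true_and] at hj ⊢
    exact (hw j).1 hj.2

theorem sum_offset_le_startCount {k m r : ℕ} (z : ℕ → Fin k) (w : Fin m → Fin k) (hm : 1 ≤ m)
    (n : ℕ) :
    ∑ s ∈ range (r + 1 - m), #{j ∈ range (n / r) | window z m (j * r + s) = w} ≤
      startCount z w n := by
  rw [← card_sigma]
  refine card_le_card_of_injOn (fun p => p.2 * r + p.1) ?_ ?_
  · rintro ⟨s, j⟩ hp
    simp only [coe_sigma, Set.mem_sigma_iff, coe_range, Set.mem_Iio, coe_filter, mem_range,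
      Set.mem_ofPred_eq] at hp ⊢
    refine ⟨?_, hp.2.2⟩
    calc j * r + s < (j + 1) * r := by have := hp.1; rw [add_mul]; omega
      _ ≤ n / r * r := Nat.mul_le_mul_right _ hp.2.1
      _ ≤ n := Nat.div_mul_le_self n r
  · rintro ⟨s, j⟩ hp ⟨s', j'⟩ hp' heq
    simp only [coe_sigma, Set.mem_sigma_iff, coe_range, Set.mem_Iio] at hp hp' heq
    have hs : s < r := by omega
    have hs' : s' < r := by omega
    have h1 : s = s' := by
      simpa [Nat.mod_eq_of_lt hs, Nat.mod_eq_of_lt hs'] using congrArg (· % r) heq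
    subst h1
    have h2 : j * r = j' * r := by omega
    rw [Nat.eq_of_mul_eq_mul_right (by omega) h2]

theorem le_startCount_of_le_aligned {k m r n : ℕ} (z : ℕ → Fin k) (w : Fin m → Fin k)
    (hm : 1 ≤ m) (hr : m ≤ r) {b : ℝ}
    (hb : ∀ v : Fin r → Fin k, b ≤ #{j ∈ range (n / r) | window z r (j * r) = v}) :
    ((r + 1 - m : ℕ) : ℝ) * ((k : ℝ) ^ (r - m) * b) ≤ startCount z w n := by
  have h1 : ∀ s ∈ range (r + 1 - m),
      (k : ℝ) ^ (r - m) * b ≤ #{j ∈ range (n / r) | window z m (j * r + s) = w} := by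
    intro s hs
    have hs : s + m ≤ r := by have := mem_range.1 hs; omega
    rw [← sum_aligned_eq z w hs, Nat.cast_sum]
    have := card_nsmul_le_sum
      (univ.filter fun v : Fin r → Fin k => ∀ i : Fin m, v ⟨s + i, by omega⟩ = w i)
      (fun v => (#{j ∈ range (n / r) | window z r (j * r) = v} : ℝ)) b (fun v _ => hb v)
    rw [card_filter_window_eq w hs, nsmul_eq_mul] at this
    exact_mod_cast this
  have h2 := card_nsmul_le_sum (range (r + 1 - m)) _ _ h1
  rw [card_range, nsmul_eq_mul] at h2
  refine h2.trans ?_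
  exact_mod_cast sum_offset_le_startCount z w hm n

theorem tendsto_startCount_div_of_lower {k m : ℕ} (hk : 0 < k) (z : ℕ → Fin k)
    (h : ∀ w : Fin m → Fin k, ∀ ε > 0, ∀ᶠ n : ℕ in atTop,
      (1 / (k : ℝ) ^ m - ε) * n ≤ startCount z w n) (w : Fin m → Fin k) :
    Tendsto (fun n => (startCount z w n : ℝ) / n) atTop (nhds (1 / (k : ℝ) ^ m)) := by
  have hkm : (0 : ℝ) < (k : ℝ) ^ m := by positivity
  rw [Metric.tendsto_nhds]
  intro ε hε
  set η : ℝ := ε / (2 * (k : ℝ) ^ m) with hη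
  have hη0 : 0 < η := by positivity
  have hηε : (k : ℝ) ^ m * η < ε := by
    rw [hη]; field_simp; linarith
  have hk1 : (1 : ℝ) ≤ (k : ℝ) ^ m := one_le_pow₀ (by exact_mod_cast hk)
  have hη' : η < ε := lt_of_le_of_lt (by nlinarith) hηε
  filter_upwards [eventually_all.2 fun w => h w η hη0, eventually_gt_atTop 0] with n hn hn0
  have hn0 : (0 : ℝ) < n := by exact_mod_cast hn0
  have hsum : ∑ w : Fin m → Fin k, (startCount z w n : ℝ) = n := by
    exact_mod_cast sum_startCount (m := m) z n
  rw [← add_sum_erase _ _ (mem_univ w)] at hsum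
  have hle := card_nsmul_le_sum (univ.erase w) (fun w => (startCount z w n : ℝ)) _
    (fun v _ => hn v)
  have hcard : ((#(univ.erase w) : ℕ) : ℝ) = (k : ℝ) ^ m - 1 := by
    rw [card_erase_of_mem (mem_univ w), Nat.cast_sub (card_pos.2 ⟨w, mem_univ w⟩)]
    simp
  rw [nsmul_eq_mul, hcard] at hle
  rw [Real.dist_eq, abs_lt]
  constructor
  · have : 1 / (k : ℝ) ^ m - η ≤ startCount z w n / n := by
      rw [le_div_iff₀ hn0]; exact hn w
    linarith
  · have : (startCount z w n : ℝ) / n ≤ 1 / (k : ℝ) ^ m + ((k : ℝ) ^ m - 1) * η := by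
      rw [div_le_iff₀ hn0]
      have e : ((k : ℝ) ^ m - 1) * ((1 / (k : ℝ) ^ m - η) * n) =
          n - (1 / (k : ℝ) ^ m + ((k : ℝ) ^ m - 1) * η) * n := by
        field_simp
        ring
      linarith
    nlinarith

theorem isNormal_of_startCount_lower {k : ℕ} (hk : 0 < k) (z : ℕ → Fin k)
    (h : ∀ m : ℕ, 1 ≤ m → ∀ w : Fin m → Fin k, ∀ ε > 0, ∀ᶠ n : ℕ in atTop,
      (1 / (k : ℝ) ^ m - ε) * n ≤ startCount z w n) : IsNormal z := by
  intro w hw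
  have hm : 1 ≤ w.length := List.length_pos_iff.2 hw
  have hlim := tendsto_startCount_div_of_lower hk z (h _ hm) w.get
  have hlow : Tendsto (fun n : ℕ => (startCount z w.get n : ℝ) / n - (w.length : ℝ) / n) atTop
      (nhds (1 / (k : ℝ) ^ w.length)) := by
    simpa using hlim.sub (tendsto_const_div_atTop_nhds_zero_nat (w.length : ℝ))
  have hocc : ∀ n, occ (wpre z n) w = startCount z w.get (n + 1 - w.length) := fun n => by
    have := occ_wpre_ofFn z w.get n
    rwa [List.ofFn_get] at this
  refine tendsto_of_tendsto_of_tendsto_of_le_of_le hlow hlim (fun n => ?_) (fun n => ?_)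
  · show (startCount z w.get n : ℝ) / n - (w.length : ℝ) / n ≤ (occ (wpre z n) w : ℝ) / n
    rw [← sub_div]
    gcongr
    rw [hocc, sub_le_iff_le_add]
    exact_mod_cast (startCount_mono z w.get (by omega)).trans (startCount_add_le z w.get _ _)
  · show (occ (wpre z n) w : ℝ) / n ≤ (startCount z w.get n : ℝ) / n
    gcongr
    rw [hocc]
    exact startCount_mono z w.get (by omega)

theorem tendsto_elln {k : ℕ} (hk : 2 ≤ k) : Tendsto (elln k) atTop atTop := by
  unfold elln
  refine tendsto_nat_floor_atTop.comp (Tendsto.atTop_div_const (by norm_num) ?_)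
  exact (Real.tendsto_logb_atTop (by exact_mod_cast hk)).comp tendsto_natCast_atTop_atTop

theorem tendsto_epsn (k : ℕ) : Tendsto (epsn k) atTop (nhds 0) := by
  have h1 : Tendsto (fun x : ℝ => Real.log x ^ 2 / x) atTop (nhds 0) := by
    simpa using Real.tendsto_pow_log_div_mul_add_atTop 1 0 2 one_ne_zero
  have h2 := ((h1.comp tendsto_natCast_atTop_atTop).div_const (Real.log k)).sqrt.const_mul 2
  simp only [zero_div, Real.sqrt_zero, mul_zero] at h2
  refine h2.congr fun n => ?_
  simp only [epsn, Function.comp, Real.logb]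
  congr 2
  ring

theorem tendsto_pow_div_succ_pow (d : ℕ) :
    Tendsto (fun p : ℕ => (p : ℝ) ^ d / ((p : ℝ) + 1) ^ d) atTop (nhds 1) := by
  simpa [div_pow] using (tendsto_natCast_div_add_atTop (1 : ℝ)).pow d

/-- Aligned block frequencies, controlled from below along fourth powers, give normality. -/
theorem isNormal_of_aligned_lower {k : ℕ} (hk : 0 < k) (z : ℕ → Fin k) (e : ℕ → ℝ)
    (he : Tendsto e atTop (nhds 0))
    (h : ∀ r : ℕ, 1 ≤ r → ∀ᶠ p : ℕ in atTop, ∀ v : Fin r → Fin k,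
      (1 / (k : ℝ) ^ r - e p) * (p ^ 4 / r : ℕ) ≤
        #{j ∈ range (p ^ 4 / r) | window z r (j * r) = v}) : IsNormal z := by
  refine isNormal_of_startCount_lower hk z fun m hm w ε hε => ?_
  have hk' : (k : ℝ) ≠ 0 := by exact_mod_cast hk.ne'
  rcases le_or_gt (1 / (k : ℝ) ^ m) ε with hle | hlt
  · refine Eventually.of_forall fun n => le_trans ?_ (Nat.cast_nonneg _)
    exact mul_nonpos_of_nonpos_of_nonneg (by linarith) (Nat.cast_nonneg _)
  have hr : ∃ r : ℕ, m ≤ r ∧ 1 / (k : ℝ) ^ m - ε <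
      ((r + 1 - m : ℕ) : ℝ) / r * (1 / (k : ℝ) ^ m) := by
    have ht : Tendsto (fun r : ℕ => ((r + 1 - m : ℕ) : ℝ) / r * (1 / (k : ℝ) ^ m)) atTop
        (nhds (1 / (k : ℝ) ^ m)) := by
      have h1 : Tendsto (fun r : ℕ => 1 - ((m : ℝ) - 1) / r) atTop (nhds 1) := by
        simpa using (tendsto_const_div_atTop_nhds_zero_nat ((m : ℝ) - 1)).const_sub 1
      have h2 : Tendsto (fun r : ℕ => ((r + 1 - m : ℕ) : ℝ) / r) atTop (nhds 1) := by
        refine h1.congr' ?_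
        filter_upwards [eventually_ge_atTop m] with r hr
        have : (r : ℝ) ≠ 0 := by exact_mod_cast (show r ≠ 0 by omega)
        rw [Nat.cast_sub (by omega)]
        push_cast
        field_simp
        ring
      simpa using h2.mul_const (1 / (k : ℝ) ^ m)
    have := (eventually_ge_atTop m).and (ht.eventually_const_lt (sub_lt_self _ hε))
    exact this.exists
  obtain ⟨r, hmr, hrε⟩ := hr
  have hr0 : 1 ≤ r := hm.trans hmr
  have hlim : Tendsto (fun p : ℕ => ((r + 1 - m : ℕ) : ℝ) * ((k : ℝ) ^ (r - m) *
        ((1 / (k : ℝ) ^ r - e p) * (p ^ 4 / r : ℕ))) / ((p : ℝ) + 1) ^ 4) atTop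
      (nhds (((r + 1 - m : ℕ) : ℝ) / r * (1 / (k : ℝ) ^ m))) := by
    have h1 : Tendsto (fun p : ℕ => ((p ^ 4 / r : ℕ) : ℝ) / (p : ℝ) ^ 4) atTop
        (nhds (1 / (r : ℝ))) := by
      have ha := tendsto_nat_floor_mul_div_atTop (R := ℝ) (a := 1 / (r : ℝ)) (by positivity)
      have hb : Tendsto (fun p : ℕ => (p : ℝ) ^ 4) atTop atTop :=
        (tendsto_pow_atTop (by norm_num)).comp tendsto_natCast_atTop_atTop
      refine (ha.comp hb).congr fun p => ?_
      simp only [Function.comp]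
      congr 2
      rw [one_div_mul_eq_div, ← Nat.cast_pow, Nat.floor_div_natCast, Nat.floor_natCast]
    have h2 := ((((he.const_sub (1 / (k : ℝ) ^ r)).mul h1).mul
      (tendsto_pow_div_succ_pow 4)).const_mul ((k : ℝ) ^ (r - m))).const_mul
        ((r + 1 - m : ℕ) : ℝ)
    have hlimval : ((r + 1 - m : ℕ) : ℝ) * ((k : ℝ) ^ (r - m) *
        ((1 / (k : ℝ) ^ r - 0) * (1 / (r : ℝ)) * 1)) =
        ((r + 1 - m : ℕ) : ℝ) / r * (1 / (k : ℝ) ^ m) := by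
      have : (k : ℝ) ^ r = (k : ℝ) ^ (r - m) * (k : ℝ) ^ m := by
        rw [← pow_add, Nat.sub_add_cancel hmr]
      rw [this]
      field_simp
      ring
    rw [hlimval] at h2
    refine h2.congr' ?_
    filter_upwards [eventually_gt_atTop 0] with p hp
    have : (p : ℝ) ≠ 0 := by exact_mod_cast hp.ne'
    field_simp
  obtain ⟨P, hP⟩ := eventually_atTop.1 ((h r hr0).and (hlim.eventually_const_lt hrε))
  filter_upwards [eventually_ge_atTop (P ^ 4)] with n hn
  set p := n.sqrt.sqrt with hp
  have hPp : P ≤ p := by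
    rw [hp, Nat.le_sqrt', Nat.le_sqrt', ← pow_mul]
    exact hn
  have hpn : p ^ 4 ≤ n := by
    rw [show p ^ 4 = (p ^ 2) ^ 2 by ring, ← Nat.le_sqrt', ← Nat.le_sqrt']
  have hnp : n ≤ (p + 1) ^ 4 := by
    have : n < ((p + 1) ^ 2) ^ 2 := by
      rw [← Nat.sqrt_lt', ← Nat.sqrt_lt', ← hp]
      omega
    calc n ≤ ((p + 1) ^ 2) ^ 2 := this.le
      _ = (p + 1) ^ 4 := by ring
  obtain ⟨ha, hb⟩ := hP p hPp
  rw [lt_div_iff₀ (by positivity)] at hb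
  calc (1 / (k : ℝ) ^ m - ε) * n ≤ (1 / (k : ℝ) ^ m - ε) * ((p : ℝ) + 1) ^ 4 := by
        refine mul_le_mul_of_nonneg_left ?_ (by linarith)
        exact_mod_cast hnp
    _ ≤ _ := hb.le
    _ ≤ startCount z w (p ^ 4) := le_startCount_of_le_aligned z w hm hmr ha
    _ ≤ startCount z w n := by exact_mod_cast startCount_mono z w hpn

/-- The one-state shuffler which only reads the tape chosen by `b`. -/
def tapeShuffler (k : ℕ) (b : Bool) : Shuffler k := ⟨1, 0, fun _ _ => 0, fun _ => b⟩

theorem out_tapeShuffler_true {k : ℕ} (x y : ℕ → Fin k) :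
    (tapeShuffler k true).out x y = x := by
  have h : ∀ t, (tapeShuffler k true).conf x y t = ((0 : Fin 1), t, 0) := fun t => by
    induction t with
    | zero => rfl
    | succ t ih => simp only [Shuffler.conf, ih]; rfl
  funext t
  simp only [Shuffler.out, h]
  rfl

theorem out_tapeShuffler_false {k : ℕ} (x y : ℕ → Fin k) :
    (tapeShuffler k false).out x y = y := by
  have h : ∀ t, (tapeShuffler k false).conf x y t = ((0 : Fin 1), 0, t) := fun t => by
    induction t with
    | zero => rfl
    | succ t ih => simp only [Shuffler.conf, ih]; rfl
  funext t
  simp only [Shuffler.out, h]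
  rfl

/-- if `(x,y)` satisfies all constraint families `F_{N_j}` along the
checkpoints `N_j = (j+m₀)^4`, for an enumeration containing every shuffler, then
every shuffled output `S(x,y)` is normal; in particular `x` and `y` are normal. -/
theorem stmt_11 (k : ℕ) (hk : 2 ≤ k) (S : ℕ → Shuffler k)
    (hS : ∀ T : Shuffler k, ∃ i : ℕ, 1 ≤ i ∧ S i = T) (m₀ : ℕ) (x y : ℕ → Fin k)
    (hF : ∀ j : ℕ, 1 ≤ j → ∀ i ∈ Finset.Icc 1 ((j + m₀) ^ 4),
      ∀ r ∈ Finset.Icc 1 (elln k ((j + m₀) ^ 4)),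
        ∀ w : Fin r → Fin k,
          (x, y) ∈ ESet (S i) ((j + m₀) ^ 4) (List.ofFn w)) :
    (∀ T : Shuffler k, IsNormal (T.out x y)) ∧ IsNormal x ∧ IsNormal y := by
  have hpow : Tendsto (fun p : ℕ => p ^ 4) atTop atTop := tendsto_pow_atTop (by norm_num)
  have main : ∀ T : Shuffler k, IsNormal (T.out x y) := by
    intro T
    obtain ⟨i, hi, rfl⟩ := hS T
    refine isNormal_of_aligned_lower (by omega) _ (fun p => epsn k (p ^ 4))
      ((tendsto_epsn k).comp hpow) fun r hr => ?_
    filter_upwards [eventually_gt_atTop m₀, hpow.eventually_ge_atTop i,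
      ((tendsto_elln hk).comp hpow).eventually_ge_atTop r] with p hp hip hrp v
    have hE := hF (p - m₀) (by omega) i (by
        rw [Nat.sub_add_cancel hp.le]; exact mem_Icc.2 ⟨hi, hip⟩) r (by
        rw [Nat.sub_add_cancel hp.le]; exact mem_Icc.2 ⟨hr, hrp⟩) v
    rw [Nat.sub_add_cancel hp.le] at hE
    simp only [ESet, Set.mem_ofPred_eq, List.length_ofFn, alocc_wpre_ofFn, mnr] at hE
    have := (abs_lt.1 hE).1
    rw [sub_mul, one_div_mul_eq_div]
    linarith
  refine ⟨main, ?_, ?_⟩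
  · simpa only [out_tapeShuffler_true] using main (tapeShuffler k true)
  · simpa only [out_tapeShuffler_false] using main (tapeShuffler k false)
end

section
/- Let m ≥ 1, N ≥ m, L ≥ 1, D ≥ 1, ε ∈ (0, 1/10), and η ≥ 0. Let W_1, …, W_L ∈ Σ^* be finite words with |W_ℓ| ≥ N for each ℓ, and set T_L := Σ_{ℓ=1}^{L} |W_ℓ|. Assume (i) #{1 ≤ ℓ ≤ L : Δ_m(W_ℓ) ≤ ε} ≥ (1 − 6ε)·L, and (ii) Σ_{ℓ=1}^{L} |W_ℓ|·1[|W_ℓ| > D·N] ≤ η·L·N. Then for every w ∈ Σ^m, |occ(W_1⋯W_L, w)/T_L − k^{−m}| ≤ ε + 6εD + η + (m−1)/N, where W_1⋯W_L denotes the concatenation. -/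
open MeasureTheory Filter Finset
open scoped ENNReal ProbabilityTheory

theorem occ_le_length {k : ℕ} (u w : List (Fin k)) (hw : w ≠ []) : occ u w ≤ u.length := by
  have hpos := List.length_pos_iff.mpr hw
  refine (Finset.card_filter_le _ _).trans ?_
  rw [Finset.card_range]
  omega

theorem occ_append_ge {k : ℕ} (u v w : List (Fin k)) (hw : w ≠ []) :
    occ u w + occ v w ≤ occ (u ++ v) w := by
  have hpos := List.length_pos_iff.mpr hw
  unfold occ
  rw [← Finset.card_map (addLeftEmbedding u.length)
    (s := (Finset.range (v.length + 1 - w.length)).filter _), ← Finset.card_union_of_disjoint]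
  · refine Finset.card_le_card fun t ht => ?_
    simp only [Finset.mem_union, Finset.mem_filter, Finset.mem_range, Finset.mem_map,
      addLeftEmbedding_apply, List.length_append] at ht ⊢
    rcases ht with ⟨h₁, h₂⟩ | ⟨s, ⟨h₁, h₂⟩, rfl⟩
    · refine ⟨by omega, ?_⟩
      rw [List.drop_append_of_le_length (by omega), List.take_append_of_le_length, h₂]
      rw [List.length_drop]
      omega
    · refine ⟨by omega, ?_⟩
      rw [List.drop_length_add_append, h₂]
  · rw [Finset.disjoint_left]
    intro t ht ht'
    simp only [Finset.mem_filter, Finset.mem_range, Finset.mem_map,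
      addLeftEmbedding_apply] at ht ht'
    obtain ⟨s, -, rfl⟩ := ht'
    omega

theorem occ_append_le {k : ℕ} (u v w : List (Fin k)) (hw : w ≠ []) :
    occ (u ++ v) w ≤ occ u w + occ v w + (w.length - 1) := by
  have hpos := List.length_pos_iff.mpr hw
  have hsub : (Finset.range ((u ++ v).length + 1 - w.length)).filter
        (fun t => ((u ++ v).drop t).take w.length = w) ⊆
      ((Finset.range (u.length + 1 - w.length)).filter
          (fun t => (u.drop t).take w.length = w) ∪
        ((Finset.range (v.length + 1 - w.length)).filter
          (fun t => (v.drop t).take w.length = w)).map (addLeftEmbedding u.length)) ∪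
      Finset.Ico (u.length + 1 - w.length) u.length := by
    intro t ht
    simp only [Finset.mem_union, Finset.mem_filter, Finset.mem_range, Finset.mem_map,
      addLeftEmbedding_apply, List.length_append, Finset.mem_Ico] at ht ⊢
    obtain ⟨h₁, h₂⟩ := ht
    by_cases hu : t < u.length + 1 - w.length
    · refine Or.inl (Or.inl ⟨hu, ?_⟩)
      rwa [List.drop_append_of_le_length (by omega), List.take_append_of_le_length] at h₂
      rw [List.length_drop]
      omega
    · by_cases hv : t < u.length
      · exact Or.inr ⟨by omega, hv⟩
      · obtain ⟨s, rfl⟩ := Nat.exists_eq_add_of_le (not_lt.mp hv)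
        refine Or.inl (Or.inr ⟨s, ⟨by omega, ?_⟩, rfl⟩)
        rwa [List.drop_length_add_append] at h₂
  refine (Finset.card_le_card hsub).trans ((Finset.card_union_le _ _).trans ?_)
  refine add_le_add ((Finset.card_union_le _ _).trans ?_) ?_
  · rw [Finset.card_map]
    rfl
  · rw [Nat.card_Ico]
    omega

theorem sum_occ_le_occ_flatten {k : ℕ} (l : List (List (Fin k))) (w : List (Fin k))
    (hw : w ≠ []) : (l.map (occ · w)).sum ≤ occ l.flatten w := by
  induction l with
  | nil => simp
  | cons u l ih =>
    have := occ_append_ge u l.flatten w hw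
    simp only [List.map_cons, List.sum_cons, List.flatten_cons]
    omega

theorem occ_flatten_le_sum_occ {k : ℕ} (l : List (List (Fin k))) (w : List (Fin k))
    (hw : w ≠ []) :
    occ l.flatten w ≤ (l.map (occ · w)).sum + l.length * (w.length - 1) := by
  induction l with
  | nil => simpa using occ_le_length [] w hw
  | cons u l ih =>
    have := occ_append_le u l.flatten w hw
    simp only [List.map_cons, List.sum_cons, List.flatten_cons, List.length_cons, add_mul,
      one_mul]
    omega

/-- prefix frequency bookkeeping for a concatenation of segments:
if most segments pass the `m`-block test and long segments carry little mass,
then the concatenation has near-uniform `m`-block frequencies. -/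
theorem stmt_17 (k : ℕ) (hk : 2 ≤ k) (m N L D : ℕ)
    (hm : 1 ≤ m) (hN : m ≤ N) (hL : 1 ≤ L) (hD : 1 ≤ D)
    (ε η : ℝ) (hε0 : 0 < ε) (hε1 : ε < 1 / 10) (hη : 0 ≤ η)
    (W : Fin L → List (Fin k)) (hW : ∀ ℓ : Fin L, N ≤ (W ℓ).length)
    (hgood : (1 - 6 * ε) * (L : ℝ) ≤
      (Nat.card {ℓ : Fin L // TestP (W ℓ) m ε} : ℝ))
    (hlong : (∑ ℓ ∈ Finset.univ.filter (fun ℓ : Fin L => D * N < (W ℓ).length),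
        ((W ℓ).length : ℝ)) ≤ η * (L : ℝ) * (N : ℝ)) :
    ∀ w : List (Fin k), w.length = m →
      |(occ (List.ofFn W).flatten w : ℝ) / (∑ ℓ : Fin L, ((W ℓ).length : ℝ))
          - 1 / (k : ℝ) ^ m|
        ≤ ε + 6 * ε * (D : ℝ) + η + ((m : ℝ) - 1) / (N : ℝ) := by
  classical
  intro w hwm
  have hw : w ≠ [] := by
    rintro rfl
    simp at hwm
    omega
  set T : ℝ := ∑ ℓ : Fin L, ((W ℓ).length : ℝ) with hT
  set p : ℝ := 1 / (k : ℝ) ^ m with hp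
  set O : ℝ := (occ (List.ofFn W).flatten w : ℝ) with hO
  have hk1 : (1 : ℝ) ≤ (k : ℝ) := by exact_mod_cast (by omega : 1 ≤ k)
  have hp0 : 0 ≤ p := by positivity
  have hp1 : p ≤ 1 := div_le_one_of_le₀ (one_le_pow₀ hk1) (by positivity)
  have hN0 : (0 : ℝ) < N := by exact_mod_cast (by omega : 0 < N)
  have hL0 : (0 : ℝ) < L := by exact_mod_cast (by omega : 0 < L)
  have hm1 : (0 : ℝ) ≤ (m : ℝ) - 1 := sub_nonneg.mpr (by exact_mod_cast hm)
  have hTL : (L : ℝ) * N ≤ T := by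
    calc (L : ℝ) * N = ∑ _ℓ : Fin L, (N : ℝ) := by simp
      _ ≤ T := Finset.sum_le_sum fun ℓ _ => by exact_mod_cast hW ℓ
  have hT0 : 0 < T := (mul_pos hL0 hN0).trans_le hTL
  have hlow : ∑ ℓ, (occ (W ℓ) w : ℝ) ≤ O := by
    have h := sum_occ_le_occ_flatten (List.ofFn W) w hw
    rw [List.map_ofFn, List.sum_ofFn] at h
    simp only [Function.comp_apply] at h
    rw [hO]
    exact_mod_cast h
  have hupp : O ≤ ∑ ℓ, (occ (W ℓ) w : ℝ) + L * ((m : ℝ) - 1) := by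
    have h := occ_flatten_le_sum_occ (List.ofFn W) w hw
    rw [List.map_ofFn, List.sum_ofFn, List.length_ofFn, hwm] at h
    simp only [Function.comp_apply] at h
    have h' : O ≤ ((∑ ℓ, occ (W ℓ) w + L * (m - 1) : ℕ) : ℝ) := Nat.cast_le.mpr h
    rw [Nat.cast_add, Nat.cast_mul, Nat.cast_sub hm] at h'
    exact_mod_cast h'
  have hseg : ∀ ℓ, |(occ (W ℓ) w : ℝ) - (W ℓ).length * p| ≤
      ε * (W ℓ).length + (if TestP (W ℓ) m ε then 0 else (D : ℝ) * N) +
        (if D * N < (W ℓ).length then ((W ℓ).length : ℝ) else 0) := by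
    intro ℓ
    have hlen : (0 : ℝ) < (W ℓ).length := hN0.trans_le (by exact_mod_cast hW ℓ)
    have hlong0 : (0 : ℝ) ≤ if D * N < (W ℓ).length then ((W ℓ).length : ℝ) else 0 := by
      split_ifs <;> positivity
    have hεlen : 0 ≤ ε * (W ℓ).length := by positivity
    by_cases hg : TestP (W ℓ) m ε
    · have h := hg w hwm
      have heq : (occ (W ℓ) w : ℝ) - (W ℓ).length * p =
          (W ℓ).length * ((occ (W ℓ) w : ℝ) / (W ℓ).length - p) := by
        field_simp
      rw [if_pos hg, heq, abs_mul, abs_of_pos hlen]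
      nlinarith [mul_le_mul_of_nonneg_left h hlen.le]
    · have hocc : (occ (W ℓ) w : ℝ) ≤ (W ℓ).length := by exact_mod_cast occ_le_length _ _ hw
      have hdev : |(occ (W ℓ) w : ℝ) - (W ℓ).length * p| ≤ (W ℓ).length := by
        rw [abs_le]
        constructor <;>
          nlinarith [mul_nonneg hlen.le hp0, mul_le_mul_of_nonneg_left hp1 hlen.le,
            Nat.cast_nonneg (α := ℝ) (occ (W ℓ) w)]
      rw [if_neg hg]
      by_cases hl : D * N < (W ℓ).length
      · rw [if_pos hl]
        have : (0 : ℝ) ≤ (D : ℝ) * N := by positivity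
        linarith
      · rw [if_neg hl]
        have : ((W ℓ).length : ℝ) ≤ (D : ℝ) * N := by exact_mod_cast not_lt.mp hl
        linarith
  have hbad : ∑ ℓ, (if TestP (W ℓ) m ε then 0 else (D : ℝ) * N) ≤ 6 * ε * L * (D * N) := by
    have hsum : ∑ ℓ, (if TestP (W ℓ) m ε then 0 else (D : ℝ) * N) =
        (L - (Nat.card {ℓ : Fin L // TestP (W ℓ) m ε} : ℝ)) * (D * N) := by
      have hcompl : ∀ ℓ, (if TestP (W ℓ) m ε then 0 else (D : ℝ) * N) =
          D * N - if TestP (W ℓ) m ε then (D : ℝ) * N else 0 := fun ℓ => by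
        split_ifs <;> ring
      simp only [hcompl, Finset.sum_sub_distrib, ← Finset.sum_filter, Finset.sum_const,
        Finset.card_univ, Fintype.card_fin, nsmul_eq_mul, Nat.card_eq_fintype_card,
        Fintype.card_subtype]
      ring
    rw [hsum]
    exact mul_le_mul_of_nonneg_right (by linarith) (by positivity)
  have hdev : |∑ ℓ, (occ (W ℓ) w : ℝ) - T * p| ≤
      ε * T + 6 * ε * L * (D * N) + η * L * N := by
    rw [hT, Finset.sum_mul, ← Finset.sum_sub_distrib]
    refine (Finset.abs_sum_le_sum_abs _ _).trans ((Finset.sum_le_sum fun ℓ _ => hseg ℓ).trans ?_)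
    rw [Finset.sum_add_distrib, Finset.sum_add_distrib, ← Finset.mul_sum, ← Finset.sum_filter]
    linarith
  have hmain : |O - T * p| ≤ (ε + 6 * ε * D + η + ((m : ℝ) - 1) / N) * T := by
    have hc : 0 ≤ 6 * ε * D + η + ((m : ℝ) - 1) / N := by positivity
    have hmul := mul_le_mul_of_nonneg_left hTL hc
    have heq : (6 * ε * D + η + ((m : ℝ) - 1) / N) * (L * N) =
        6 * ε * L * (D * N) + η * L * N + L * ((m : ℝ) - 1) := by
      field_simp
    have hLm : 0 ≤ (L : ℝ) * ((m : ℝ) - 1) := by positivity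
    rw [abs_le] at hdev ⊢
    constructor <;> linarith [hdev.1, hdev.2]
  have hdiv : O / T - p = (O - T * p) / T := by
    field_simp
  rwa [hdiv, abs_div, abs_of_pos hT0, div_le_iff₀ hT0]
end

section
/- Let x ∈ Σ^∞ be normal, let N ≥ 1, ε > 0, and let B ⊆ Σ^N satisfy |B| ≤ ε·k^N. Write x = u₁u₂u₃⋯ for the aligned decomposition of x into consecutive blocks of length N, i.e. u_ℓ := x[(ℓ−1)N+1 .. ℓN]. Then limsup_{L→∞} (#{1 ≤ ℓ ≤ L : u_ℓ ∈ B})/L ≤ 2ε. -/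
open MeasureTheory Filter Finset
open scoped ENNReal ProbabilityTheory

/-- The length-`m` factor of `wpre x n` at a position `t` with `t + m ≤ n`. -/
theorem take_drop_wpre {k : ℕ} (x : ℕ → Fin k) {n t m : ℕ} (h : t + m ≤ n) :
    ((wpre x n).drop t).take m = List.ofFn fun i : Fin m => x (t + i) := by
  apply List.ext_getElem
  · simp [wpre]; omega
  · intro i h₁ h₂
    simp [wpre]

theorem occ_wpre_add {k : ℕ} (x : ℕ → Fin k) (n m : ℕ) (w : Fin (m + 1) → Fin k) :
    occ (wpre x (n + m)) (List.ofFn w) =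
      #{t ∈ range n | (fun i : Fin (m + 1) => x (t + i)) = w} := by
  have hlen : (wpre x (n + m)).length = n + m := by simp [wpre]
  unfold occ
  rw [hlen, List.length_ofFn, show n + m + 1 - (m + 1) = n by omega]
  congr 1
  refine filter_congr fun t ht => ?_
  rw [take_drop_wpre x (by have := mem_range.1 ht; omega), List.ofFn_inj]

theorem IsNormal.tendsto_card_div {k : ℕ} {x : ℕ → Fin k} (hx : IsNormal x) (m : ℕ)
    (w : Fin (m + 1) → Fin k) :
    Tendsto (fun n : ℕ => (#{t ∈ range n | (fun i : Fin (m + 1) => x (t + i)) = w} : ℝ) / n)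
      atTop (nhds (1 / (k : ℝ) ^ (m + 1))) := by
  have h := (tendsto_add_atTop_iff_nat m).2 (hx (List.ofFn w) (by simp))
  simp only [occ_wpre_add, List.length_ofFn] at h
  have hratio : Tendsto (fun n : ℕ => ((n + m : ℕ) : ℝ) / n) atTop (nhds 1) := by
    have h₁ : Tendsto (fun n : ℕ => 1 + (m : ℝ) / n) atTop (nhds (1 + 0)) :=
      tendsto_const_nhds.add (tendsto_const_div_atTop_nhds_zero_nat _)
    rw [add_zero] at h₁
    refine h₁.congr' ?_
    filter_upwards [eventually_gt_atTop 0] with n hn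
    have : (n : ℝ) ≠ 0 := by positivity
    push_cast
    field_simp
  have h₂ := h.mul hratio
  rw [mul_one] at h₂
  refine h₂.congr' ?_
  filter_upwards [eventually_gt_atTop 0] with n hn
  have : (n : ℝ) ≠ 0 := by positivity
  have : ((n + m : ℕ) : ℝ) ≠ 0 := by positivity
  field_simp

/-- Along a normal word, the averages of a function of the window at position `t` converge to
the uniform mean. -/
theorem IsNormal.tendsto_average {k : ℕ} {x : ℕ → Fin k} (hx : IsNormal x) {m : ℕ} (hm : m ≠ 0)
    (g : (Fin m → Fin k) → ℝ) :
    Tendsto (fun n : ℕ => (∑ t ∈ range n, g fun i => x (t + i)) / n)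
      atTop (nhds ((∑ w, g w) / (k : ℝ) ^ m)) := by
  obtain ⟨m, rfl⟩ := Nat.exists_eq_succ_of_ne_zero hm
  have h := tendsto_finsetSum univ fun (w : Fin (m + 1) → Fin k) _ =>
    (hx.tendsto_card_div m w).mul_const (g w)
  have hlim : ∑ w : Fin (m + 1) → Fin k, 1 / (k : ℝ) ^ (m + 1) * g w =
      (∑ w, g w) / (k : ℝ) ^ (m + 1) := by
    rw [← mul_sum]; ring
  rw [hlim] at h
  refine h.congr fun n => ?_
  simp_rw [div_mul_eq_mul_div]
  rw [← sum_div]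
  congr 1
  rw [← sum_fiberwise (range n) (fun t => fun i : Fin (m + 1) => x (t + i))]
  refine sum_congr rfl fun w _ => ?_
  rw [sum_congr rfl (g := fun _ => g w) fun t ht => by rw [(mem_filter.1 ht).2]]
  simp

/-- Second moment of a sum of independent centred variables, uniform on a finite type. -/
theorem sum_sq_sum_apply_of_sum_eq_zero {A : Type*} [Fintype A] (f : A → ℝ) (hf : ∑ a, f a = 0)
    (R : ℕ) :
    (∑ v : Fin R → A, (∑ j, f (v j)) ^ 2) * Fintype.card A =
      R * (Fintype.card A : ℝ) ^ R * ∑ a, f a ^ 2 := by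
  induction R with
  | zero => simp
  | succ R ih =>
    have hstep : ∑ v : Fin (R + 1) → A, (∑ j, f (v j)) ^ 2 =
        (Fintype.card A : ℝ) ^ R * ∑ a, f a ^ 2 +
          Fintype.card A * ∑ v : Fin R → A, (∑ j, f (v j)) ^ 2 := by
      rw [← (Fin.consEquiv fun _ : Fin (R + 1) => A).sum_comp, Fintype.sum_prod_type]
      simp only [Fin.consEquiv_apply, Fin.sum_univ_succ, Fin.cons_zero, Fin.cons_succ, add_sq,
        sum_add_distrib, sum_const, card_univ, nsmul_eq_mul, Fintype.card_pi, prod_const,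
        Fintype.card_fin]
      simp only [← mul_sum, ← sum_mul, hf]
      push_cast
      ring
    rw [hstep, add_mul, mul_assoc (Fintype.card A : ℝ), ih]
    push_cast
    ring

theorem sum_range_sub_le_sum_range_add {a : ℕ → ℝ} (h₀ : ∀ n, 0 ≤ a n) (h₁ : ∀ n, a n ≤ 1)
    (L j : ℕ) : ∑ q ∈ range L, a q - j ≤ ∑ q ∈ range L, a (q + j) := by
  have h := sum_range_add a j L
  have h' := sum_range_add a L j
  rw [add_comm j L] at h
  have hj : ∑ q ∈ range j, a q ≤ j := by
    simpa using sum_le_sum fun q (_ : q ∈ range j) => h₁ q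
  have hL : 0 ≤ ∑ q ∈ range j, a (L + q) := sum_nonneg fun _ _ => h₀ _
  simp only [add_comm _ j]
  linarith

/-- Density bound from a window-deviation functional: replacing a `[0, 1]`-valued sequence by its
window sums costs only a boundary term. -/
theorem sum_range_le_of_window {a : ℕ → ℝ} (h₀ : ∀ n, 0 ≤ a n) (h₁ : ∀ n, a n ≤ 1)
    {R : ℕ} (hR : 0 < R) (p : ℝ) {η : ℝ} (hη : 0 < η) (L : ℕ) :
    ∑ q ∈ range L, a q ≤ R + (p + η) * L +
      (∑ q ∈ range L, (∑ j : Fin R, (a (q + j) - p)) ^ 2) / (4 * η * R ^ 2) := by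
  have hR' : (0 : ℝ) < R := by exact_mod_cast hR
  have hlow : R * (∑ q ∈ range L, a q - R) ≤ ∑ q ∈ range L, ∑ j : Fin R, a (q + j) := by
    rw [sum_comm]
    calc (R : ℝ) * (∑ q ∈ range L, a q - R) = ∑ _j : Fin R, (∑ q ∈ range L, a q - R) := by
          rw [sum_const, card_univ, Fintype.card_fin, nsmul_eq_mul]
      _ ≤ _ := sum_le_sum fun j _ => by
        have := sum_range_sub_le_sum_range_add h₀ h₁ L j
        have : ((j : ℕ) : ℝ) ≤ R := by exact_mod_cast j.2.le
        linarith
  have hup : ∑ q ∈ range L, ∑ j : Fin R, a (q + j) ≤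
      ∑ q ∈ range L, (R * (p + η) + (∑ j : Fin R, (a (q + j) - p)) ^ 2 / (4 * η * R)) := by
    refine sum_le_sum fun q _ => ?_
    have hS : ∑ j : Fin R, (a (q + j) - p) = ∑ j : Fin R, a (q + j) - R * p := by
      simp [sum_sub_distrib]
    rw [hS]
    set s := ∑ j : Fin R, a (q + j)
    have : s - R * p - R * η ≤ (s - R * p) ^ 2 / (4 * η * R) := by
      rw [le_div_iff₀ (by positivity)]
      nlinarith [sq_nonneg (s - R * p - 2 * (η * R))]
    linarith
  rw [sum_add_distrib, ← sum_div] at hup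
  simp only [sum_const, card_range, nsmul_eq_mul] at hup
  have h := hlow.trans hup
  refine le_of_mul_le_mul_left ?_ hR'
  have hD : (R : ℝ) * ((∑ q ∈ range L, (∑ j : Fin R, (a (q + j) - p)) ^ 2) / (4 * η * R ^ 2)) =
      (∑ q ∈ range L, (∑ j : Fin R, (a (q + j) - p)) ^ 2) / (4 * η * R) := by
    field_simp
  rw [mul_add, hD]
  linarith

theorem sum_range_mul_le {G : ℕ → ℝ} (hG : ∀ t, 0 ≤ G t) {N : ℕ} (hN : 0 < N) (L : ℕ) :
    ∑ q ∈ range L, G (q * N) ≤ ∑ t ∈ range (L * N), G t := by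
  rw [← sum_image (f := G) (g := fun q => q * N) fun q _ r _ h => Nat.eq_of_mul_eq_mul_right hN h]
  refine sum_le_sum_of_subset_of_nonneg (fun t ht => ?_) fun t _ _ => hG t
  obtain ⟨q, hq, rfl⟩ := mem_image.1 ht
  exact mem_range.2 (Nat.mul_lt_mul_of_pos_right (mem_range.1 hq) hN)

/-- The mean-square deviation over windows of `R` aligned blocks of the number of hits of
a set `P` of blocks grows at most linearly in `R`. -/
theorem sum_sq_deviation_le {k N : ℕ} (hk : 0 < k) (P : (Fin N → Fin k) → Prop) [DecidablePred P]
    {p : ℝ} (hp : p = (#{u | P u} : ℝ) / (k : ℝ) ^ N) (R : ℕ) :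
    (∑ w : Fin (R * N) → Fin k,
      (∑ j : Fin R, ((if P fun i => w (finProdFinEquiv (j, i)) then 1 else 0) - p)) ^ 2) /
        (k : ℝ) ^ (R * N) ≤ R := by
  have hk' : (0 : ℝ) < k := by exact_mod_cast hk
  set f : (Fin N → Fin k) → ℝ := fun u => (if P u then 1 else 0) - p with hf
  have hcard : (Fintype.card (Fin N → Fin k) : ℝ) = (k : ℝ) ^ N := by simp
  have hp₀ : 0 ≤ p := by rw [hp]; positivity
  have hp₁ : p ≤ 1 := by
    rw [hp, div_le_one (by positivity), ← hcard]
    exact_mod_cast card_le_univ _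
  have hf₀ : ∑ u, f u = 0 := by
    simp only [hf, sum_sub_distrib, sum_boole, sum_const, card_univ, nsmul_eq_mul, hcard]
    rw [hp]; field_simp; simp
  have hf₂ : ∑ u, f u ^ 2 ≤ (k : ℝ) ^ N := by
    rw [← hcard]
    calc ∑ u, f u ^ 2 ≤ ∑ _u : Fin N → Fin k, (1 : ℝ) := sum_le_sum fun u _ => by
          simp only [hf]; split_ifs <;> nlinarith
      _ = _ := by simp
  have hmom := sum_sq_sum_apply_of_sum_eq_zero f hf₀ R
  let e : (Fin (R * N) → Fin k) ≃ (Fin R → Fin N → Fin k) :=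
    (Equiv.arrowCongr finProdFinEquiv.symm (Equiv.refl _)).trans (Equiv.curry _ _ _)
  have hsum : ∑ w : Fin (R * N) → Fin k, (∑ j : Fin R, f fun i => w (finProdFinEquiv (j, i))) ^ 2 =
      ∑ v : Fin R → Fin N → Fin k, (∑ j, f (v j)) ^ 2 :=
    e.sum_comp fun v => (∑ j, f (v j)) ^ 2
  change (∑ w : Fin (R * N) → Fin k,
    (∑ j : Fin R, f fun i => w (finProdFinEquiv (j, i))) ^ 2) / _ ≤ _
  rw [hsum, div_le_iff₀ (by positivity)]
  rw [hcard] at hmom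
  refine le_of_mul_le_mul_right (a := (k : ℝ) ^ N) ?_ (by positivity)
  rw [hmom, mul_comm R N, pow_mul]
  gcongr

/-- in a normal word, any small family `B` of length-`N` blocks
appears with small density along the aligned block decomposition. -/
theorem stmt_18 (k : ℕ) (hk : 2 ≤ k) (x : ℕ → Fin k) (hx : IsNormal x)
    (N : ℕ) (hN : 1 ≤ N) (ε : ℝ) (hε : 0 < ε)
    (B : Finset (List (Fin k))) (hB : ∀ u ∈ B, u.length = N)
    (hcard : (B.card : ℝ) ≤ ε * (k : ℝ) ^ N) :
    limsup (fun L : ℕ =>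
        (((Finset.range L).filter fun ℓ =>
            (List.ofFn fun i : Fin N => x (ℓ * N + (i : ℕ))) ∈ B).card : ℝ) / (L : ℝ))
      atTop ≤ 2 * ε := by
  have hk₀ : 0 < k := by omega
  obtain ⟨R, hRN⟩ := exists_nat_ge ((N : ℝ) / ε ^ 2)
  have hN' : (0 : ℝ) < N := by exact_mod_cast hN
  have hR' : (0 : ℝ) < R := lt_of_lt_of_le (by positivity) hRN
  have hR : 0 < R := by exact_mod_cast hR'
  let P : (Fin N → Fin k) → Prop := fun u => List.ofFn u ∈ B
  let p : ℝ := (#{u | P u} : ℝ) / (k : ℝ) ^ N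
  have hpε : p ≤ ε := by
    rw [div_le_iff₀ (by positivity)]
    refine le_trans ?_ hcard
    exact_mod_cast card_le_card_of_injOn List.ofFn (fun u hu => (mem_filter.1 hu).2)
      List.ofFn_injective.injOn
  let a : ℕ → ℝ := fun ℓ => if P fun i => x (ℓ * N + i) then 1 else 0
  have ha₀ : ∀ n, 0 ≤ a n := fun n => by simp only [a]; split_ifs <;> norm_num
  have ha₁ : ∀ n, a n ≤ 1 := fun n => by simp only [a]; split_ifs <;> norm_num
  let g : (Fin (R * N) → Fin k) → ℝ := fun w =>
    (∑ j : Fin R, ((if P fun i => w (finProdFinEquiv (j, i)) then 1 else 0) - p)) ^ 2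
  have hg : ∀ q, (∑ j : Fin R, (a (q + j) - p)) ^ 2 = g fun i => x (q * N + i) := fun q => by
    have hidx : ∀ (j : Fin R) (i : Fin N), (q + j) * N + i = q * N + (i + N * j) :=
      fun j i => by ring
    simp only [a, g, finProdFinEquiv_apply_val, hidx]
  let M : ℝ := (∑ w, g w) / (k : ℝ) ^ (R * N)
  have hM : M ≤ R := sum_sq_deviation_le hk₀ P rfl R
  have havg : Tendsto (fun L : ℕ => (∑ t ∈ range (L * N), g fun i => x (t + i)) / ((L * N : ℕ) : ℝ))
      atTop (nhds M) :=
    (hx.tendsto_average (Nat.mul_pos hR hN).ne' g).comp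
      (tendsto_id.atTop_mul_const' hN)
  let U : ℕ → ℝ := fun L => (R : ℝ) / L + (p + ε / 2) +
    (∑ t ∈ range (L * N), g fun i => x (t + i)) / ((L * N : ℕ) : ℝ) * (N / (4 * (ε / 2) * R ^ 2))
  have hU : Tendsto U atTop (nhds (0 + (p + ε / 2) + M * (N / (4 * (ε / 2) * R ^ 2)))) :=
    ((tendsto_const_div_atTop_nhds_zero_nat _).add_const _).add (havg.mul_const _)
  have hle : (fun L : ℕ => (((Finset.range L).filter fun ℓ =>
      (List.ofFn fun i : Fin N => x (ℓ * N + (i : ℕ))) ∈ B).card : ℝ) / (L : ℝ)) ≤ᶠ[atTop] U := by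
    filter_upwards [eventually_gt_atTop 0] with L hL
    have hL' : (0 : ℝ) < L := by exact_mod_cast hL
    have hcount : (((Finset.range L).filter fun ℓ =>
        (List.ofFn fun i : Fin N => x (ℓ * N + (i : ℕ))) ∈ B).card : ℝ) =
        ∑ q ∈ range L, a q := by
      simp only [a, P, sum_boole]
    have hwin := sum_range_le_of_window ha₀ ha₁ hR p (half_pos hε) L
    simp only [hg] at hwin
    have hsub := sum_range_mul_le (G := fun t => g fun i => x (t + i))
      (fun t => sq_nonneg _) hN L
    rw [hcount, div_le_iff₀ hL']
    refine hwin.trans ?_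
    have hUL : U L * L = R + (p + ε / 2) * L +
        (∑ t ∈ range (L * N), g fun i => x (t + i)) / (4 * (ε / 2) * R ^ 2) := by
      simp only [U]
      push_cast
      field_simp
    rw [hUL]
    gcongr
  have hbound : 0 + (p + ε / 2) + M * (N / (4 * (ε / 2) * R ^ 2)) ≤ 2 * ε := by
    have h₁ : M * (N / (4 * (ε / 2) * R ^ 2)) ≤ R * (N / (4 * (ε / 2) * R ^ 2)) := by gcongr
    have h₂ : R * (N / (4 * (ε / 2) * R ^ 2)) ≤ ε / 2 := by
      rw [div_le_iff₀ (by positivity)] at hRN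
      rw [show R * (N / (4 * (ε / 2) * (R : ℝ) ^ 2)) = N / (2 * ε * R) by field_simp; ring,
        div_le_iff₀ (by positivity)]
      linarith
    linarith
  refine le_trans (limsup_le_limsup hle ?_ hU.isBoundedUnder_le) (hU.limsup_eq.trans_le hbound)
  exact IsBoundedUnder.isCoboundedUnder_le
    ⟨0, eventually_map.2 (Eventually.of_forall fun L => by positivity)⟩
end
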